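/- Under the standing assumptions (fixed 0<ε<1/4, n^{1/2−o(1)} < k < sqrt((1/4−ε)·n·log n), Λ(Δ) < o(1) a.s., and φ ≤ φ*), almost surely H = H_k(n,p) does not contain a clique having two vertices each of degree at least λ in the clique. Equivalently, almost surely there do not exist vertices x, y and families F ⊆ H_x, G ⊆ H_y with |F| = |G| = λ such that F and G are cross-intersecting (every member of F meets every member of G). -/

import Mathlib

open Filter

noncomputable section

/-- The collection of all `k`-element subsets of `Fin n`. -/
def kSets (n k : ℕ) : Finset (Finset (Fin n)) := Finset.powersetCard k Finset.univ

open Classical in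
/-- The probability that the random hypergraph `H_k(n,p)` (each `k`-subset of `[n]`
present independently with probability `p`) satisfies the property `P`. -/
def hprob (n k : ℕ) (p : ℝ) (P : Finset (Finset (Fin n)) → Prop) : ℝ :=
  ∑ H ∈ (kSets n k).powerset,
    if P H then p ^ H.card * (1 - p) ^ ((kSets n k).card - H.card) else 0

/-- A family of sets is intersecting (a clique) if no two of its members are disjoint. -/
def IsClique {n : ℕ} (C : Finset (Finset (Fin n))) : Prop :=
  ∀ A ∈ C, ∀ B ∈ C, (A ∩ B).Nonempty

/-- The star of `x` in `H`: the set of edges of `H` containing `x`. -/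
def starOf {n : ℕ} (H : Finset (Finset (Fin n))) (x : Fin n) : Finset (Finset (Fin n)) :=
  H.filter (fun A => x ∈ A)

/-- The degree of `x` in `H`. -/
def vdeg {n : ℕ} (H : Finset (Finset (Fin n))) (x : Fin n) : ℕ := (starOf H x).card

/-- The maximum degree of `H`. -/
def maxDegree {n : ℕ} (H : Finset (Finset (Fin n))) : ℕ :=
  Finset.univ.sup (vdeg H)

/-- A family is nontrivial if it is not contained in a star. -/
def IsNontrivial {n : ℕ} (C : Finset (Finset (Fin n))) : Prop :=
  ¬ ∃ x : Fin n, ∀ A ∈ C, x ∈ A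

/-- `H` satisfies (strong) EKR if every maximum-size intersecting subfamily of `H`
is a star of `H`. -/
def EKR {n : ℕ} (H : Finset (Finset (Fin n))) : Prop :=
  ∀ C ⊆ H, IsClique C → (∀ D ⊆ H, IsClique D → D.card ≤ C.card) →
    ∃ x : Fin n, C = starOf H x

open Classical in
/-- `q = q(n,k)`: the probability that two independent uniform `k`-subsets of `[n]` meet. -/
def interProb (n k : ℕ) : ℝ :=
  ((((kSets n k) ×ˢ (kSets n k)).filter fun AB => (AB.1 ∩ AB.2).Nonempty).card : ℝ) /
    ((kSets n k).card : ℝ) ^ 2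

/-- `φ = p·C(n-1,k-1)`, the expected degree of a vertex. -/
def phi (n k : ℕ) (p : ℝ) : ℝ := p * ((n - 1).choose (k - 1) : ℝ)

/-- `μ̄ = φ·n/k`, the expected number of edges. -/
def mubar (n k : ℕ) (p : ℝ) : ℝ := phi n k p * n / k

/-- The generalized binomial coefficient `C(x,t) = x(x-1)⋯(x-t+1)/t!`. -/
def gchoose (x : ℝ) (t : ℕ) : ℝ := (∏ i ∈ Finset.range t, (x - i)) / (t.factorial : ℝ)

/-- `Λ(t) = C(μ̄,t)·q^{C(t,2)}`. -/
def Lam (n k : ℕ) (p : ℝ) (t : ℕ) : ℝ :=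
  gchoose (mubar n k p) t * interProb n k ^ t.choose 2

/-- `Λ'(t)`: equals `0` for `t ≤ 2` and `Λ(t)` otherwise. -/
def Lam' (n k : ℕ) (p : ℝ) (t : ℕ) : ℝ := if t ≤ 2 then 0 else Lam n k p t

open Classical in
/-- The probability of `E` for a uniform sample from the finite set `s`. -/
def uprob {α : Type*} (s : Finset α) (E : α → Prop) : ℝ :=
  ((s.filter E).card : ℝ) / (s.card : ℝ)

open Classical in
/-- The probability of `E` under the probability mass function `w` on `Ω`. -/
def wprob {Ω : Type*} [Fintype Ω] (w : Ω → ℝ) (E : Ω → Prop) : ℝ :=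
  ∑ ω ∈ Finset.univ.filter E, w ω

open Classical in
/-- The probability that the family `{A_1,…,A_m}` formed by `m` independent uniform
`k`-subsets of `[n]` satisfies `P`. -/
def iidprob (n k m : ℕ) (P : Finset (Finset (Fin n)) → Prop) : ℝ :=
  uprob ((Finset.univ : Finset (Fin m → Finset (Fin n))).filter fun f => ∀ i, f i ∈ kSets n k)
    (fun f => P (Finset.image f Finset.univ))

open Classical in
/-- The probability that the tuple `(A_1,…,A_m)` of independent uniform `k`-subsets of `[n]`
satisfies `P`. -/
def tupleProb (n k m : ℕ) (P : (Fin m → Finset (Fin n)) → Prop) : ℝ :=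
  uprob ((Finset.univ : Finset (Fin m → Finset (Fin n))).filter fun f => ∀ i, f i ∈ kSets n k) P

/-- `Pr(Bin(M,p) ≥ θ)`. -/
def binomProbGe (M : ℕ) (p : ℝ) (θ : ℕ) : ℝ :=
  ∑ j ∈ Finset.Icc θ M, (M.choose j : ℝ) * p ^ j * (1 - p) ^ (M - j)

/-- `φ* = log³ n / log(1/q)`. -/
def phiStar (n k : ℕ) : ℝ := (Real.log n) ^ 3 / Real.log (1 / interProb n k)

/-- `α₁`: the largest integer `t` with `Pr(Bin(C(n-1,k-1),p) ≥ t) ≥ ψ/n`, where `ψ = log n`. -/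
def alpha1 (n k : ℕ) (p : ℝ) : ℕ :=
  sSup {t : ℕ | Real.log n / n ≤ binomProbGe ((n - 1).choose (k - 1)) p t}

/-- `α₂ = min{t : Λ(t) ≤ σ}`. -/
def alpha2 (n k : ℕ) (p σn : ℝ) : ℕ := sInf {t : ℕ | Lam n k p t ≤ σn}

/-- `α = max{α₁, α₂}`. -/
def alphaP (n k : ℕ) (p σn : ℝ) : ℕ := max (alpha1 n k p) (alpha2 n k p σn)

/-- `γ = min{α, φ*/3}`. -/
def gammaP (n k : ℕ) (p σn : ℝ) : ℕ := min (alphaP n k p σn) ⌊phiStar n k / 3⌋₊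

/-- `τ = (1-ε)·γ`. -/
def tauP (ε : ℝ) (n k : ℕ) (p σn : ℝ) : ℝ := (1 - ε) * (gammaP n k p σn : ℝ)

/-- `λ = max{√(log n)/log(1/q), 2·√(log n/log(1/q))}`. -/
def lamP (n k : ℕ) : ℝ :=
  max (Real.sqrt (Real.log n) / Real.log (1 / interProb n k))
    (2 * Real.sqrt (Real.log n / Real.log (1 / interProb n k)))

/-- `w̄ = max{φ²k²/n, 6 log n}`. -/
def wbar (n k : ℕ) (p : ℝ) : ℝ := max (phi n k p ^ 2 * (k : ℝ) ^ 2 / n) (6 * Real.log n)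

/-- `q̄ = (1 + 2k²w̄/(q n²))·q`. -/
def qbar (n k : ℕ) (p : ℝ) : ℝ :=
  (1 + 2 * (k : ℝ) ^ 2 * wbar n k p / (interProb n k * (n : ℝ) ^ 2)) * interProb n k

open Classical in
/-- The probability that the random subset of `H`, keeping each element independently
with probability `ρ`, satisfies `P`. -/
def sprob {β : Type*} [DecidableEq β] (H : Finset β) (ρ : ℝ) (P : Finset β → Prop) : ℝ :=
  ∑ G ∈ H.powerset, if P G then ρ ^ G.card * (1 - ρ) ^ (H.card - G.card) else 0

/-- The degree of `v` in the multiset `{f 0, …, f (m-1)}` (with multiplicity). -/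
def tdeg {n m : ℕ} (f : Fin m → Finset (Fin n)) (v : Fin n) : ℕ :=
  (Finset.univ.filter fun i => v ∈ f i).card

/-- An increasing (up-)event in `{0,1}^ι`. -/
def IncrEvent {ι : Type*} (A : Set (ι → Bool)) : Prop :=
  ∀ x y : ι → Bool, y ≤ x → y ∈ A → x ∈ A

/-- The coordinate `i` affects the event `A`. -/
def Affects {ι : Type*} (i : ι) (A : Set (ι → Bool)) : Prop :=
  ∃ η ∈ A, ∃ ν, ν ∉ A ∧ ∀ j, j ≠ i → η j = ν j

/-- Negative association of a family of `{0,1}`-valued random variables, defined on the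
finite probability space `Ω` with probability mass function `w`. -/
def NegAssoc {Ω ι : Type*} [Fintype Ω] (w : Ω → ℝ) (X : ι → Ω → Bool) : Prop :=
  ∀ A B : Set (ι → Bool), IncrEvent A → IncrEvent B →
    (∀ i, ¬ (Affects i A ∧ Affects i B)) →
    wprob w (fun ω => (fun i => X i ω) ∈ A ∧ (fun i => X i ω) ∈ B) ≤
      wprob w (fun ω => (fun i => X i ω) ∈ A) * wprob w (fun ω => (fun i => X i ω) ∈ B)

/-- `X = X_1 + ⋯ + X_m` for `{0,1}`-valued random variables. -/
def bcount {Ω : Type*} {m : ℕ} (X : Fin m → Ω → Bool) (ω : Ω) : ℕ :=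
  (Finset.univ.filter fun i => X i ω = true).card

end

section helpers

lemma sum_superset {β : Type*} [DecidableEq β] (K S : Finset β) (hS : S ⊆ K) (p : ℝ) :
    ∑ H ∈ K.powerset.filter (fun H => S ⊆ H), p ^ H.card * (1 - p) ^ (K.card - H.card)
      = p ^ S.card := by
  have h1 : ∑ H ∈ K.powerset.filter (fun H => S ⊆ H),
      p ^ H.card * (1 - p) ^ (K.card - H.card) =
      ∑ J ∈ (K \ S).powerset, p ^ S.card *
        (p ^ J.card * (1 - p) ^ ((K \ S).card - J.card)) := by
    refine Finset.sum_nbij' (fun H => H \ S) (fun J => J ∪ S) ?_ ?_ ?_ ?_ ?_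
    · intro H hH
      simp only [Finset.mem_filter, Finset.mem_powerset] at hH ⊢
      exact Finset.sdiff_subset_sdiff hH.1 (le_refl _)
    · intro J hJ
      simp only [Finset.mem_filter, Finset.mem_powerset] at hJ ⊢
      exact ⟨Finset.union_subset (hJ.trans Finset.sdiff_subset) hS, Finset.subset_union_right⟩
    · intro H hH
      simp only [Finset.mem_filter, Finset.mem_powerset] at hH ⊢
      exact Finset.sdiff_union_of_subset hH.2
    · intro J hJ
      simp only [Finset.mem_powerset] at hJ
      ext a
      have := @hJ a
      simp only [Finset.mem_sdiff, Finset.mem_union] at *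
      tauto
    · intro H hH
      simp only [Finset.mem_filter, Finset.mem_powerset] at hH
      rw [Finset.card_sdiff_of_subset hH.2, Finset.card_sdiff_of_subset hS, ← mul_assoc, ← pow_add]
      have a1 := Finset.card_le_card hH.1
      have a2 := Finset.card_le_card hH.2
      congr 2 <;> omega
  rw [h1, ← Finset.mul_sum, Finset.sum_pow_mul_eq_add_pow]
  simp

lemma hprob_not (n k : ℕ) (p : ℝ) (P : Finset (Finset (Fin n)) → Prop) :
    hprob n k p (fun H => ¬ P H) = 1 - hprob n k p P := by
  have h := Finset.sum_pow_mul_eq_add_pow p (1 - p) (kSets n k)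
  have h2 : hprob n k p (fun H => ¬ P H) + hprob n k p P = 1 := by
    unfold hprob
    rw [← Finset.sum_add_distrib]
    rw [show p + (1 - p) = 1 by ring, one_pow] at h
    refine Eq.trans ?_ h
    apply Finset.sum_congr rfl
    intro H _
    by_cases hP : P H <;> simp [hP]
  linarith

lemma hprob_nonneg (n k : ℕ) (p : ℝ) (h0 : 0 ≤ p) (h1 : p ≤ 1)
    (P : Finset (Finset (Fin n)) → Prop) : 0 ≤ hprob n k p P := by
  unfold hprob
  apply Finset.sum_nonneg
  intro H _
  have : 0 ≤ 1 - p := by linarith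
  split_ifs <;> positivity

lemma hprob_or3 (n k : ℕ) (p : ℝ) (h0 : 0 ≤ p) (h1 : p ≤ 1)
    (P A B C : Finset (Finset (Fin n)) → Prop)
    (h : ∀ H ⊆ kSets n k, P H → A H ∨ B H ∨ C H) :
    hprob n k p P ≤ hprob n k p A + hprob n k p B + hprob n k p C := by
  unfold hprob
  rw [← Finset.sum_add_distrib, ← Finset.sum_add_distrib]
  apply Finset.sum_le_sum
  intro H hH
  have := h H (Finset.mem_powerset.1 hH)
  have h2 : 0 ≤ 1 - p := by linarith
  have h3 : 0 ≤ p ^ H.card * (1 - p) ^ ((kSets n k).card - H.card) := by positivity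
  by_cases a : A H <;> by_cases b : B H <;> by_cases c : C H <;> by_cases d : P H <;>
    simp only [a, b, c, d, if_true, if_false] <;> first | linarith | (exfalso; tauto)

lemma hprob_union (n k : ℕ) (p : ℝ) (h0 : 0 ≤ p) (h1 : p ≤ 1)
    (P : Finset (Finset (Fin n)) → Prop) {ι : Type*} (I : Finset ι)
    (S : ι → Finset (Finset (Fin n))) (hS : ∀ i ∈ I, S i ⊆ kSets n k)
    (h : ∀ H ⊆ kSets n k, P H → ∃ i ∈ I, S i ⊆ H) :
    hprob n k p P ≤ ∑ i ∈ I, p ^ (S i).card := by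
  have h2 : 0 ≤ 1 - p := by linarith
  have e : ∑ i ∈ I, p ^ (S i).card = ∑ i ∈ I, ∑ H ∈ (kSets n k).powerset,
      if S i ⊆ H then p ^ H.card * (1 - p) ^ ((kSets n k).card - H.card) else 0 := by
    apply Finset.sum_congr rfl
    intro i hi
    rw [← Finset.sum_filter, sum_superset _ _ (hS i hi)]
  rw [e, Finset.sum_comm]
  unfold hprob
  apply Finset.sum_le_sum
  intro H hH
  have h3 : 0 ≤ p ^ H.card * (1 - p) ^ ((kSets n k).card - H.card) := by positivity
  have h4 : ∀ i ∈ I, 0 ≤ if S i ⊆ H then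
      p ^ H.card * (1 - p) ^ ((kSets n k).card - H.card) else 0 := by
    intro i _
    split_ifs <;> simp [h3]
  by_cases hP : P H
  · obtain ⟨i, hi, hi2⟩ := h H (Finset.mem_powerset.1 hH) hP
    rw [if_pos hP]
    refine le_trans ?_ (Finset.single_le_sum h4 hi)
    rw [if_pos hi2]
  · rw [if_neg hP]
    exact Finset.sum_nonneg h4

/-- number of `κ`-subsets of `V` containing `T`. -/
lemma card_sup_le {α : Type*} [DecidableEq α] (V T : Finset α) (hT : T ⊆ V) (κ : ℕ) :
    ((Finset.powersetCard κ V).filter (fun A => T ⊆ A)).card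
      ≤ (V.card - T.card).choose (κ - T.card) := by
  rw [← Finset.card_sdiff_of_subset hT, ← Finset.card_powersetCard]
  apply Finset.card_le_card_of_injOn (fun A => A \ T)
  · intro A hA
    simp only [Finset.coe_filter, Set.mem_ofPred_eq, Finset.mem_powersetCard,
      Finset.mem_coe] at hA ⊢
    exact ⟨Finset.sdiff_subset_sdiff hA.1.1 (le_refl _), by
      rw [Finset.card_sdiff_of_subset hA.2, hA.1.2]⟩
  · intro A hA B hB hAB
    simp only [Finset.coe_filter, Set.mem_ofPred_eq] at hA hB
    rw [← Finset.sdiff_union_of_subset hA.2, ← Finset.sdiff_union_of_subset hB.2]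
    simp only at hAB
    rw [hAB]

lemma choose_sub_le (n k : ℕ) (hkn : k ≤ n) (s : ℕ) (hs : s ≤ k) :
    n ^ s * (n - s).choose (k - s) ≤ k ^ s * n.choose k := by
  induction s with
  | zero => simp
  | succ s ih =>
    have ih := ih (by omega)
    have e1 : n - s = (n - (s+1)) + 1 := by omega
    have e2 : k - s = (k - (s+1)) + 1 := by omega
    have h := Nat.add_one_mul_choose_eq (n - (s+1)) (k - (s+1))
    rw [← e1, ← e2] at h
    -- h : (n-s) * C(n-s-1,k-s-1) = C(n-s,k-s) * (k-s)
    have hpos : 0 < n - s := by omega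
    have h3 : (k - s) * n ≤ k * (n - s) := by
      zify [show s ≤ k by omega, show s ≤ n by omega]
      have : (s:ℤ) * k ≤ s * n := by exact_mod_cast Nat.mul_le_mul_left s hkn
      nlinarith
    apply Nat.le_of_mul_le_mul_left _ hpos
    calc (n - s) * (n ^ (s+1) * (n - (s+1)).choose (k - (s+1)))
        = n ^ (s+1) * ((n - s) * (n - (s+1)).choose (k - (s+1))) := by ring
      _ = (n ^ s * (n - s).choose (k - s)) * ((k - s) * n) := by rw [h]; ring
      _ ≤ (k ^ s * n.choose k) * (k * (n - s)) := Nat.mul_le_mul ih h3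
      _ = _ := by ring

/-- level monotonicity for up-closed predicates -/
lemma level_mono {α : Type*} [DecidableEq α] (V : Finset α) (U : Finset α → Prop)
    [DecidablePred U] (hU : ∀ B C, B ⊆ C → U B → U C) (κ : ℕ) :
    ((Finset.powersetCard κ V).filter U).card * (V.card - κ)
      ≤ ((Finset.powersetCard (κ + 1) V).filter U).card * (κ + 1) := by
  apply Finset.card_mul_le_card_mul (fun B C => B ⊆ C)
  · intro B hB
    simp only [Finset.mem_filter, Finset.mem_powersetCard] at hB
    rw [← hB.1.2, ← Finset.card_sdiff_of_subset hB.1.1]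
    apply Finset.card_le_card_of_injOn (fun v => insert v B)
    · intro v hv
      simp only [Finset.mem_coe, Finset.mem_sdiff] at hv
      simp only [Finset.bipartiteAbove, Finset.mem_coe, Finset.mem_filter,
        Finset.mem_powersetCard]
      refine ⟨⟨⟨Finset.insert_subset hv.1 hB.1.1, ?_⟩, hU _ _ (Finset.subset_insert _ _) hB.2⟩,
        Finset.subset_insert _ _⟩
      rw [Finset.card_insert_of_notMem hv.2]
    · intro v hv w hw hvw
      simp only [Finset.mem_coe, Finset.mem_sdiff] at hv hw
      have : v ∈ insert w B := by
        simp only at hvw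
        rw [← hvw]; exact Finset.mem_insert_self _ _
      rcases Finset.mem_insert.1 this with h | h
      · exact h
      · exact absurd h hv.2
  · intro C hC
    simp only [Finset.mem_filter, Finset.mem_powersetCard] at hC
    calc _ ≤ (Finset.powersetCard κ C).card := by
          apply Finset.card_le_card
          intro B hB
          simp only [Finset.bipartiteBelow, Finset.mem_filter, Finset.mem_powersetCard] at hB ⊢
          exact ⟨hB.2, hB.1.1.2⟩
      _ = κ + 1 := by
          rw [Finset.card_powersetCard, hC.1.2, Nat.choose_succ_self_right]

lemma card_insert_split {α : Type*} [DecidableEq α] (V : Finset α) (v : α) (hv : v ∉ V)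
    (U : Finset α → Prop) [DecidablePred U] (hUv : ∀ B, U (insert v B) ↔ U B) (κ : ℕ) :
    ((Finset.powersetCard (κ + 1) (insert v V)).filter U).card =
      ((Finset.powersetCard (κ + 1) V).filter U).card +
      ((Finset.powersetCard κ V).filter U).card := by
  rw [Finset.powersetCard_succ_insert hv, Finset.filter_union, Finset.card_union_of_disjoint]
  · congr 1
    rw [Finset.filter_image, Finset.card_image_of_injOn]
    · congr 1
      apply Finset.filter_congr
      intro B _
      exact hUv B
    · intro A hA B hB hAB
      simp only [Finset.coe_filter, Set.mem_ofPred_eq, Finset.mem_powersetCard] at hA hB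
      have h1 : v ∉ A := fun h => hv (hA.1.1 h)
      have h2 : v ∉ B := fun h => hv (hB.1.1 h)
      have hAB2 : insert v A = insert v B := hAB
      rw [← Finset.erase_insert h1, ← Finset.erase_insert h2, hAB2]
  · rw [Finset.disjoint_left]
    intro A hA hA2
    simp only [Finset.mem_filter, Finset.mem_powersetCard, Finset.mem_image] at hA hA2
    obtain ⟨⟨B, _, rfl⟩, _⟩ := hA2
    exact hv (hA.1.1 (Finset.mem_insert_self _ _))

lemma remove_one {α : Type*} [DecidableEq α] (V : Finset α) (v : α) (hv : v ∉ V)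
    (U : Finset α → Prop) [DecidablePred U] (hU : ∀ B C, B ⊆ C → U B → U C)
    (hUv : ∀ B, U (insert v B) ↔ U B) (κ : ℕ) (hκ : κ ≤ V.card) :
    ((Finset.powersetCard κ (insert v V)).filter U).card * V.card.choose κ ≤
      ((Finset.powersetCard κ V).filter U).card * (V.card + 1).choose κ := by
  cases κ with
  | zero => simp
  | succ κ =>
    rw [card_insert_split V v hv U hUv κ, Nat.choose_succ_succ, add_mul, mul_add, add_comm]
    apply Nat.add_le_add_right
    have h := level_mono V U hU κ
    have h2 := Nat.choose_succ_right_eq V.card κ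
    have hpos : 0 < (V.card - κ) := by omega
    apply Nat.le_of_mul_le_mul_left _ hpos
    calc _ = (((Finset.powersetCard κ V).filter U).card * (V.card - κ)) *
            V.card.choose (κ+1) := by ring
      _ ≤ (((Finset.powersetCard (κ+1) V).filter U).card * (κ + 1)) * V.card.choose (κ+1) :=
          Nat.mul_le_mul_right _ h
      _ = ((Finset.powersetCard (κ+1) V).filter U).card * (V.card.choose (κ+1) * (κ + 1)) := by
          ring
      _ = _ := by rw [h2]; ring

lemma remove_many {α : Type*} [DecidableEq α] (V : Finset α)
    (U : Finset α → Prop) [DecidablePred U] (hU : ∀ B C, B ⊆ C → U B → U C) (κ : ℕ)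
    (hκ : κ ≤ V.card) (T : Finset α) : Disjoint T V →
    (∀ v ∈ T, ∀ B, U (insert v B) ↔ U B) →
    ((Finset.powersetCard κ (T ∪ V)).filter U).card * V.card.choose κ ≤
      ((Finset.powersetCard κ V).filter U).card * (T.card + V.card).choose κ := by
  induction T using Finset.induction_on with
  | empty => intro _ _; simp
  | insert v T hvT ih =>
    intro hd hUT
    rw [Finset.disjoint_insert_left] at hd
    have ih := ih hd.2 (fun w hw => hUT w (Finset.mem_insert_of_mem hw))
    have hvn : v ∉ T ∪ V := by simp [hvT, hd.1]
    have hc : (T ∪ V).card = T.card + V.card := Finset.card_union_of_disjoint hd.2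
    have h := remove_one (T ∪ V) v hvn U hU (hUT v (Finset.mem_insert_self _ _)) κ (by omega)
    rw [hc] at h
    rw [Finset.insert_union, Finset.card_insert_of_notMem hvT]
    have hpos : 0 < (T.card + V.card).choose κ := Nat.choose_pos (by omega)
    apply Nat.le_of_mul_le_mul_left _ hpos
    calc _ = (((Finset.powersetCard κ (insert v (T ∪ V))).filter U).card *
            (T.card + V.card).choose κ) * V.card.choose κ := by ring
      _ ≤ (((Finset.powersetCard κ (T ∪ V)).filter U).card * (T.card + V.card + 1).choose κ) *
            V.card.choose κ := Nat.mul_le_mul_right _ h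
      _ = (((Finset.powersetCard κ (T ∪ V)).filter U).card * V.card.choose κ) *
            (T.card + V.card + 1).choose κ := by ring
      _ ≤ _ := Nat.mul_le_mul_right _ ih
      _ = _ := by
        rw [show T.card + 1 + V.card = T.card + V.card + 1 by ring]; ring

open Classical in
/-- negative correlation: hitting pairwise disjoint sets -/
lemma neg_corr {α ι : Type*} [DecidableEq α] [DecidableEq ι] (V : Finset α) (κ a : ℕ) (ha : κ + a ≤ V.card)
    (F : Finset ι) (T : ι → Finset α) (hTV : ∀ i ∈ F, T i ⊆ V) (hTa : ∀ i ∈ F, (T i).card ≤ a)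
    (hd : ∀ i ∈ F, ∀ j ∈ F, i ≠ j → Disjoint (T i) (T j)) :
    (((Finset.powersetCard κ V).filter (fun B => ∀ i ∈ F, (B ∩ T i).Nonempty)).card : ℝ) ≤
      (V.card.choose κ : ℝ) *
        (1 - ((V.card - a).choose κ : ℝ) / (V.card.choose κ : ℝ)) ^ F.card := by
  induction F using Finset.induction_on with
  | empty => simp
  | insert i F hi ih =>
    have ih := ih (fun j hj => hTV j (Finset.mem_insert_of_mem hj))
      (fun j hj => hTa j (Finset.mem_insert_of_mem hj))
      (fun j hj l hl => hd j (Finset.mem_insert_of_mem hj) l (Finset.mem_insert_of_mem hl))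
    set U : Finset α → Prop := fun B => ∀ i ∈ F, (B ∩ T i).Nonempty with hUdef
    have hU : ∀ B C, B ⊆ C → U B → U C := by
      intro B C hBC hB j hj
      exact (hB j hj).mono (Finset.inter_subset_inter_right hBC)
    have hTi := hTV i (Finset.mem_insert_self _ _)
    have hTia := hTa i (Finset.mem_insert_self _ _)
    have hcard : (V \ T i).card = V.card - (T i).card := Finset.card_sdiff_of_subset hTi
    have hUT : ∀ v ∈ T i, ∀ B, U (insert v B) ↔ U B := by
      intro v hv B
      simp only [hUdef]
      refine forall₂_congr fun j hj => ?_
      have hvj : v ∉ T j := by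
        intro h
        have := hd i (Finset.mem_insert_self _ _) j (Finset.mem_insert_of_mem hj)
          (by rintro rfl; exact hi hj)
        exact Finset.disjoint_left.1 this hv h
      rw [Finset.insert_inter_of_notMem hvj]
    have hm := remove_many (V \ T i) U hU κ (by omega) (T i) Finset.disjoint_sdiff hUT
    rw [Finset.union_sdiff_of_subset hTi, hcard,
      show (T i).card + (V.card - (T i).card) = V.card by omega] at hm
    have hsplit : ((Finset.powersetCard κ V).filter
          (fun B => ∀ j ∈ insert i F, (B ∩ T j).Nonempty)).card +
        ((Finset.powersetCard κ (V \ T i)).filter U).card ≤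
        ((Finset.powersetCard κ V).filter U).card := by
      rw [← Finset.card_union_of_disjoint]
      · apply Finset.card_le_card
        intro B hB
        simp only [Finset.mem_union, Finset.mem_filter, Finset.mem_powersetCard] at hB ⊢
        rcases hB with hB | hB
        · exact ⟨hB.1, fun j hj => hB.2 j (Finset.mem_insert_of_mem hj)⟩
        · exact ⟨⟨hB.1.1.trans Finset.sdiff_subset, hB.1.2⟩, hB.2⟩
      · rw [Finset.disjoint_left]
        intro B hB hB2
        simp only [Finset.mem_filter, Finset.mem_powersetCard] at hB hB2
        obtain ⟨v, hv⟩ := hB.2 i (Finset.mem_insert_self _ _)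
        rw [Finset.mem_inter] at hv
        exact (Finset.mem_sdiff.1 (hB2.1.1 hv.1)).2 hv.2
    have hCpos : (0:ℝ) < (V.card.choose κ : ℝ) := by
      exact_mod_cast Nat.choose_pos (by omega)
    have hmono : ((V.card - a).choose κ : ℝ) ≤ ((V.card - (T i).card).choose κ : ℝ) := by
      exact_mod_cast Nat.choose_le_choose κ (by omega)
    have hr : ((V.card - a).choose κ : ℝ) / (V.card.choose κ : ℝ) ≤ 1 := by
      rw [div_le_one hCpos]
      exact_mod_cast Nat.choose_le_choose κ (by omega)
    rw [Finset.card_insert_of_notMem hi, pow_succ]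
    have hm' : ((((Finset.powersetCard κ V).filter U).card : ℝ)) *
        ((V.card - (T i).card).choose κ : ℝ) ≤
        (((Finset.powersetCard κ (V \ T i)).filter U).card : ℝ) * (V.card.choose κ : ℝ) := by
      exact_mod_cast hm
    have hs' : (((Finset.powersetCard κ V).filter
          (fun B => ∀ j ∈ insert i F, (B ∩ T j).Nonempty)).card : ℝ) +
        (((Finset.powersetCard κ (V \ T i)).filter U).card : ℝ) ≤
        (((Finset.powersetCard κ V).filter U).card : ℝ) := by exact_mod_cast hsplit
    have h5 : (((Finset.powersetCard κ V).filter U).card : ℝ) *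
        (((V.card - a).choose κ : ℝ) / (V.card.choose κ : ℝ)) ≤
        (((Finset.powersetCard κ (V \ T i)).filter U).card : ℝ) := by
      rw [← mul_div_assoc, div_le_iff₀ hCpos]
      exact (mul_le_mul_of_nonneg_left hmono (by positivity)).trans hm'
    calc _ ≤ (((Finset.powersetCard κ V).filter U).card : ℝ) *
          (1 - ((V.card - a).choose κ : ℝ) / (V.card.choose κ : ℝ)) := by linarith
      _ ≤ _ := by
        rw [← mul_assoc]
        exact mul_le_mul_of_nonneg_right ih (by linarith)

lemma interProb_eq (n k : ℕ) (hk : k ≤ n) :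
    interProb n k = 1 - ((n - k).choose k : ℝ) / (n.choose k : ℝ) := by
  classical
  have hpos : (0:ℝ) < (n.choose k : ℝ) := by exact_mod_cast Nat.choose_pos hk
  have hc : (kSets n k).card = n.choose k := by simp [kSets]
  have h1 : (((kSets n k) ×ˢ (kSets n k)).filter fun AB => ¬ (AB.1 ∩ AB.2).Nonempty).card
      = n.choose k * (n - k).choose k := by
    rw [Finset.card_filter, Finset.sum_product]
    have : ∀ A ∈ kSets n k, (∑ B ∈ kSets n k, if ¬ (A ∩ B).Nonempty then 1 else 0)
        = (n - k).choose k := by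
      intro A hA
      rw [← Finset.card_filter]
      have hA2 : A.card = k := (Finset.mem_powersetCard.1 hA).2
      have : (kSets n k).filter (fun B => ¬ (A ∩ B).Nonempty) = Finset.powersetCard k Aᶜ := by
        ext B
        simp only [kSets, Finset.mem_filter, Finset.mem_powersetCard, Finset.subset_univ,
          true_and, Finset.not_nonempty_iff_eq_empty, ← Finset.disjoint_iff_inter_eq_empty]
        rw [and_comm, Finset.subset_compl_iff_disjoint_left]
      rw [this, Finset.card_powersetCard, Finset.card_compl, hA2, Fintype.card_fin]
    rw [Finset.sum_congr rfl this, Finset.sum_const, hc, smul_eq_mul]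
  have h2 := Finset.card_filter_add_card_filter_not (s := (kSets n k) ×ˢ (kSets n k))
    (fun AB => (AB.1 ∩ AB.2).Nonempty)
  rw [h1, Finset.card_product, hc] at h2
  have h3 : ((((kSets n k) ×ˢ (kSets n k)).filter fun AB => (AB.1 ∩ AB.2).Nonempty).card : ℝ)
      = (n.choose k : ℝ) * n.choose k - n.choose k * (n - k).choose k := by
    rw [eq_sub_iff_add_eq]
    exact_mod_cast h2
  unfold interProb
  rw [hc]
  have h4 : ((((kSets n k) ×ˢ (kSets n k)).filter fun AB => (AB.1 ∩ AB.2).Nonempty).card : ℝ) /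
    ((n.choose k : ℕ) : ℝ) ^ 2 = 1 - ((n - k).choose k : ℝ) / (n.choose k : ℝ) := by
    rw [h3]
    field_simp
  convert h4

lemma ratio_eq (n k : ℕ) :
    ((n - k).choose k : ℝ) / (n.choose k : ℝ) =
      ((n - k).descFactorial k : ℝ) / (n.descFactorial k : ℝ) := by
  rw [Nat.descFactorial_eq_factorial_mul_choose, Nat.descFactorial_eq_factorial_mul_choose]
  push_cast
  rw [mul_div_mul_left]
  exact_mod_cast Nat.factorial_ne_zero k

lemma ratio_lower (n k : ℕ) (h : 2 * k < n) :
    (1 - (k : ℝ) / ((n : ℝ) - k)) ^ k ≤ ((n - k).choose k : ℝ) / (n.choose k : ℝ) := by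
  rw [ratio_eq, le_div_iff₀ (by exact_mod_cast Nat.descFactorial_pos.2 (by omega)),
    Nat.descFactorial_eq_prod_range, Nat.descFactorial_eq_prod_range]
  push_cast
  have hn : (2:ℝ) * k < n := by exact_mod_cast h
  have hk : (0:ℝ) ≤ k := by positivity
  have h1 : (k:ℝ) / ((n:ℝ) - k) ≤ 1 := by
    rw [div_le_one (by linarith)]; linarith
  calc _ = ∏ i ∈ Finset.range k, ((1 - (k : ℝ) / ((n : ℝ) - k)) * ((n - i : ℕ) : ℝ)) := by
        rw [Finset.prod_mul_distrib, Finset.prod_const, Finset.card_range]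
    _ ≤ _ := by
      apply Finset.prod_le_prod
      · intro i _
        have : 0 ≤ 1 - (k : ℝ) / ((n : ℝ) - k) := by linarith
        positivity
      · intro i hi
        rw [Finset.mem_range] at hi
        rw [Nat.cast_sub (by omega), Nat.cast_sub (by omega), Nat.cast_sub (by omega)]
        have hi' : (i:ℝ) ≤ k := by exact_mod_cast hi.le
        have : (k:ℝ) ≤ (k : ℝ) / ((n : ℝ) - k) * ((n:ℝ) - i) := by
          rw [div_mul_eq_mul_div, le_div_iff₀ (by linarith)]
          nlinarith
        nlinarith

lemma ratio_upper (n k : ℕ) (h : 2 * k < n) :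
    ((n - k).choose k : ℝ) / (n.choose k : ℝ) ≤ (1 - (k : ℝ) / (n : ℝ)) ^ k := by
  rw [ratio_eq, div_le_iff₀ (by exact_mod_cast Nat.descFactorial_pos.2 (by omega)),
    Nat.descFactorial_eq_prod_range, Nat.descFactorial_eq_prod_range]
  push_cast
  have hn : (2:ℝ) * k < n := by exact_mod_cast h
  have hk : (0:ℝ) ≤ k := by positivity
  calc _ ≤ ∏ i ∈ Finset.range k, ((1 - (k : ℝ) / (n : ℝ)) * ((n - i : ℕ) : ℝ)) := by
        apply Finset.prod_le_prod
        · intro i _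
          positivity
        · intro i hi
          rw [Finset.mem_range] at hi
          rw [Nat.cast_sub (by omega), Nat.cast_sub (by omega), Nat.cast_sub (by omega)]
          have hi' : (0:ℝ) ≤ i := by positivity
          have : (k : ℝ) / (n : ℝ) * ((n:ℝ) - i) ≤ k := by
            rw [div_mul_eq_mul_div, div_le_iff₀ (by linarith)]
            nlinarith
          nlinarith
    _ = _ := by
      rw [Finset.prod_mul_distrib, Finset.prod_const, Finset.card_range]

lemma hit_le_q (n k : ℕ) (hk : 1 ≤ k) (h : 2 * k < n) :
    1 - ((n - 2 - (k - 1)).choose (k - 1) : ℝ) / ((n - 2).choose (k - 1) : ℝ) ≤ interProb n k := by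
  rw [interProb_eq n k (by omega)]
  obtain ⟨j, rfl⟩ : ∃ j, k = j + 1 := ⟨k - 1, by omega⟩
  obtain ⟨N, rfl⟩ : ∃ N, n = N + (j + 1) + 1 := ⟨n - (j + 1) - 1, by omega⟩
  have e1 := Nat.add_one_mul_choose_eq (N + (j+1)) j
  have e2 := Nat.add_one_mul_choose_eq N j
  rw [show N + (j+1) + 1 - (j+1) = N + 1 by omega, show j + 1 - 1 = j by omega,
    show N + (j+1) + 1 - 2 - j = N by omega, show N + (j+1) + 1 - 2 = N + j by omega]
  have p1 : (0:ℝ) < ((N + (j+1) + 1).choose (j+1) : ℝ) := by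
    exact_mod_cast Nat.choose_pos (by omega)
  have p2 : (0:ℝ) < ((N + j).choose j : ℝ) := by exact_mod_cast Nat.choose_pos (by omega)
  have e3 : (N + j).choose j ≤ (N + (j+1)).choose j := Nat.choose_le_choose j (by omega)
  have e1' : ((N:ℝ) + (j+1) + 1) * ((N + (j+1)).choose j : ℝ) =
    ((N + (j+1) + 1).choose (j+1) : ℝ) * (j+1) := by exact_mod_cast e1
  have e2' : ((N:ℝ) + 1) * (N.choose j : ℝ) = ((N + 1).choose (j+1) : ℝ) * (j+1) := by
    exact_mod_cast e2
  have e3' : ((N + j).choose j : ℝ) ≤ ((N + (j+1)).choose j : ℝ) := by exact_mod_cast e3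
  have hj : (0:ℝ) < (j:ℝ) + 1 := by positivity
  have : ((N + 1).choose (j+1) : ℝ) / ((N + (j+1) + 1).choose (j+1) : ℝ) ≤
      (N.choose j : ℝ) / ((N + j).choose j : ℝ) := by
    rw [div_le_div_iff₀ p1 p2]
    have : ((N + 1).choose (j+1) : ℝ) * ((N + j).choose j : ℝ) * (j+1) ≤
        (N.choose j : ℝ) * ((N + (j+1) + 1).choose (j+1) : ℝ) * (j+1) := by
      calc _ = ((N + 1).choose (j+1) * (j+1) : ℝ) * ((N + j).choose j : ℝ) := by ring
        _ = (N.choose j : ℝ) * (((N:ℝ) + 1) * ((N + j).choose j : ℝ)) := by rw [← e2']; ring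
        _ ≤ (N.choose j : ℝ) * (((N:ℝ) + (j+1) + 1) * ((N + (j+1)).choose j : ℝ)) := by
          gcongr
          linarith
        _ = _ := by rw [e1']; ring
    exact le_of_mul_le_mul_right this hj
  linarith

open Classical in
lemma SF_card (n k : ℕ) (hk : 2 ≤ k) (h2k : 2 * k < n) (x y : Fin n) (hxy : x ≠ y)
    (F : Finset (Finset (Fin n))) (hF : ∀ A ∈ F, A ∈ kSets n k ∧ x ∈ A ∧ y ∉ A) (s : ℕ)
    (hs : ∀ A ∈ F, ∀ A' ∈ F, A ≠ A' → (A ∩ A').card ≤ s) :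
    (((kSets n k).filter (fun B => (y ∈ B ∧ x ∉ B) ∧ ∀ A ∈ F, (A ∩ B).Nonempty)).card : ℝ) ≤
      ((n - 1).choose (k - 1) : ℝ) *
        (interProb n k ^ F.card + (F.card : ℝ) ^ 2 * s * k / n) := by
  set V : Finset (Fin n) := ({x, y} : Finset (Fin n))ᶜ with hV
  have hVc : V.card = n - 2 := by
    rw [hV, Finset.card_compl, Finset.card_pair hxy, Fintype.card_fin]
  set W : Finset (Fin n) := F.offDiag.biUnion (fun P => (P.1 ∩ P.2).erase x) with hW
  have hWc : W.card ≤ F.card ^ 2 * s := by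
    calc W.card ≤ F.offDiag.card * s := by
          apply Finset.card_biUnion_le_card_mul
          intro P hP
          rw [Finset.mem_offDiag] at hP
          exact (Finset.card_erase_le).trans (hs _ hP.1 _ hP.2.1 hP.2.2)
      _ ≤ _ := by
          apply Nat.mul_le_mul_right
          rw [Finset.offDiag_card, sq]
          omega
  have hWV : W ⊆ V := by
    intro w hw
    simp only [hW, Finset.mem_biUnion, Finset.mem_offDiag, Finset.mem_erase,
      Finset.mem_inter] at hw
    obtain ⟨P, hP, hwx, hw1, hw2⟩ := hw
    simp only [hV, Finset.mem_compl, Finset.mem_insert, Finset.mem_singleton, not_or]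
    refine ⟨hwx, ?_⟩
    rintro rfl
    exact (hF _ hP.1).2.2 hw1
  set T : Finset (Fin n) → Finset (Fin n) := fun A => (A.erase x) \ W with hT
  set S1 := W.biUnion (fun w => (Finset.powersetCard (k-1) V).filter (fun B => {w} ⊆ B)) with hS1
  set S2 := (Finset.powersetCard (k-1) V).filter (fun B => ∀ A ∈ F, (B ∩ T A).Nonempty) with hS2
  have hmain : ((kSets n k).filter
      (fun B => (y ∈ B ∧ x ∉ B) ∧ ∀ A ∈ F, (A ∩ B).Nonempty)).card ≤ (S1 ∪ S2).card := by
    apply Finset.card_le_card_of_injOn (fun B => B.erase y)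
    · intro B hB
      simp only [kSets, Finset.coe_filter, Set.mem_ofPred_eq, Finset.mem_powersetCard] at hB
      obtain ⟨⟨_, hBk⟩, ⟨hyB, hxB⟩, hBF⟩ := hB
      have hBV : B.erase y ∈ Finset.powersetCard (k-1) V := by
        rw [Finset.mem_powersetCard]
        refine ⟨?_, by rw [Finset.card_erase_of_mem hyB, hBk]⟩
        intro b hb
        rw [Finset.mem_erase] at hb
        simp only [hV, Finset.mem_compl, Finset.mem_insert, Finset.mem_singleton, not_or]
        refine ⟨?_, hb.1⟩
        rintro rfl
        exact hxB hb.2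
      simp only [Finset.coe_union, Set.mem_union, Finset.mem_coe]
      by_cases hex : ∃ w ∈ W, w ∈ B.erase y
      · left
        obtain ⟨w, hw, hwB⟩ := hex
        rw [hS1, Finset.mem_biUnion]
        exact ⟨w, hw, Finset.mem_filter.2 ⟨hBV, Finset.singleton_subset_iff.2 hwB⟩⟩
      · right
        rw [hS2, Finset.mem_filter]
        refine ⟨hBV, fun A hA => ?_⟩
        obtain ⟨b, hb⟩ := hBF A hA
        rw [Finset.mem_inter] at hb
        have hby : b ≠ y := by rintro rfl; exact (hF A hA).2.2 hb.1
        have hbx : b ≠ x := by rintro rfl; exact hxB hb.2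
        have hbB : b ∈ B.erase y := Finset.mem_erase.2 ⟨hby, hb.2⟩
        refine ⟨b, Finset.mem_inter.2 ⟨hbB, ?_⟩⟩
        simp only [hT, Finset.mem_sdiff, Finset.mem_erase]
        exact ⟨⟨hbx, hb.1⟩, fun hbW => hex ⟨b, hbW, hbB⟩⟩
    · intro B hB C hC hBC
      simp only [kSets, Finset.coe_filter, Set.mem_ofPred_eq, Finset.mem_powersetCard] at hB hC
      have hBC2 : B.erase y = C.erase y := hBC
      rw [← Finset.insert_erase hB.2.1.1, ← Finset.insert_erase hC.2.1.1, hBC2]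
  have hc1 : S1.card ≤ W.card * (n - 2 - 1).choose (k - 1 - 1) := by
    apply Finset.card_biUnion_le_card_mul
    intro w hw
    have := card_sup_le V {w} (Finset.singleton_subset_iff.2 (hWV hw)) (k - 1)
    rwa [hVc, Finset.card_singleton] at this
  have hc2 : (S2.card : ℝ) ≤ ((n-2).choose (k-1) : ℝ) * interProb n k ^ F.card := by
    have := neg_corr V (k-1) (k-1) (by omega) F T ?_ ?_ ?_
    · have this2 : (S2.card : ℝ) ≤ (V.card.choose (k-1) : ℝ) *
          (1 - ((V.card - (k-1)).choose (k-1) : ℝ) / (V.card.choose (k-1) : ℝ)) ^ F.card := by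
        convert this
      refine this2.trans ?_
      rw [hVc]
      have hq := hit_le_q n k (by omega) h2k
      have hp : (0:ℝ) < ((n - 2).choose (k - 1) : ℝ) := by
        exact_mod_cast Nat.choose_pos (by omega)
      have hr : ((n - 2 - (k - 1)).choose (k - 1) : ℝ) / ((n - 2).choose (k - 1) : ℝ) ≤ 1 := by
        rw [div_le_one hp]
        exact_mod_cast Nat.choose_le_choose _ (by omega)
      gcongr
    · intro A hA a ha
      simp only [hT, Finset.mem_sdiff, Finset.mem_erase] at ha
      simp only [hV, Finset.mem_compl, Finset.mem_insert, Finset.mem_singleton, not_or]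
      refine ⟨ha.1.1, ?_⟩
      rintro rfl
      exact (hF _ hA).2.2 ha.1.2
    · intro A hA
      calc (T A).card ≤ (A.erase x).card := Finset.card_le_card Finset.sdiff_subset
        _ = k - 1 := by
          rw [Finset.card_erase_of_mem (hF A hA).2.1, (Finset.mem_powersetCard.1 (hF A hA).1).2]
    · intro A hA A' hA' hne
      rw [Finset.disjoint_left]
      intro a ha ha'
      simp only [hT, Finset.mem_sdiff, Finset.mem_erase] at ha ha'
      apply ha.2
      rw [hW, Finset.mem_biUnion]
      exact ⟨(A, A'), Finset.mem_offDiag.2 ⟨hA, hA', hne⟩,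
        Finset.mem_erase.2 ⟨ha.1.1, Finset.mem_inter.2 ⟨ha.1.2, ha'.1.2⟩⟩⟩
  have hc3 := choose_sub_le (n-2) (k-1) (by omega) 1 (by omega)
  rw [pow_one, pow_one] at hc3
  have hnpos : (0:ℝ) < n := by exact_mod_cast (by omega : 0 < n)
  have hc3' : ((n - 2 - 1).choose (k - 1 - 1) : ℝ) ≤ ((n-2).choose (k-1) : ℝ) * (k / n) := by
    rw [← mul_div_assoc, le_div_iff₀ hnpos]
    have h3 : (((n-2:ℕ):ℝ)) * ((n - 2 - 1).choose (k - 1 - 1) : ℝ) ≤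
      ((k-1:ℕ):ℝ) * ((n-2).choose (k-1) : ℝ) := by exact_mod_cast hc3
    rw [Nat.cast_sub (by omega), Nat.cast_sub (by omega)] at h3
    push_cast at h3
    have hk' : (2:ℝ) ≤ k := by exact_mod_cast hk
    have h2k' : (2:ℝ) * k < n := by exact_mod_cast h2k
    have ha : (0:ℝ) ≤ ((n - 2 - 1).choose (k - 1 - 1) : ℝ) := by positivity
    have hb : (0:ℝ) ≤ ((n-2).choose (k-1) : ℝ) := by positivity
    have hn2 : (0:ℝ) < n - 2 := by linarith
    refine le_of_mul_le_mul_right ?_ hn2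
    calc _ = (n:ℝ) * (((n:ℝ) - 2) * ((n - 2 - 1).choose (k - 1 - 1) : ℝ)) := by ring
      _ ≤ (n:ℝ) * (((k:ℝ) - 1) * ((n-2).choose (k-1) : ℝ)) := by gcongr
      _ = ((n:ℝ) * ((k:ℝ) - 1)) * ((n-2).choose (k-1) : ℝ) := by ring
      _ ≤ ((k:ℝ) * (n - 2)) * ((n-2).choose (k-1) : ℝ) := by
        gcongr ?_ * _
        nlinarith
      _ = _ := by ring
  have hq0 : 0 ≤ interProb n k := by unfold interProb; positivity
  have hmono : ((n-2).choose (k-1) : ℝ) ≤ ((n-1).choose (k-1) : ℝ) := by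
    exact_mod_cast Nat.choose_le_choose _ (by omega)
  calc _ ≤ ((S1 ∪ S2).card : ℝ) := by exact_mod_cast hmain
    _ ≤ (S1.card : ℝ) + S2.card := by exact_mod_cast Finset.card_union_le _ _
    _ ≤ ((F.card : ℝ) ^ 2 * s) * (((n-2).choose (k-1) : ℝ) * (k / n)) +
        ((n-2).choose (k-1) : ℝ) * interProb n k ^ F.card := by
      refine add_le_add ?_ hc2
      calc (S1.card : ℝ) ≤ (W.card : ℝ) * ((n - 2 - 1).choose (k - 1 - 1) : ℝ) := by
            exact_mod_cast hc1
        _ ≤ _ := by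
          gcongr
          exact_mod_cast hWc
    _ = ((n-2).choose (k-1) : ℝ) *
        (interProb n k ^ F.card + (F.card : ℝ) ^ 2 * s * k / n) := by ring
    _ ≤ _ := by gcongr

lemma E1_bound (n k s : ℕ) (p : ℝ) (h0 : 0 ≤ p) (h1 : p ≤ 1) (hk : k ≤ n) (hn : 0 < n) :
    hprob n k p (fun H => ∃ A ∈ H, ∃ B ∈ H, A ≠ B ∧ s < (A ∩ B).card) ≤
      (p * (n.choose k : ℝ)) ^ 2 * (((k:ℝ) ^ 2 / n) ^ s / (s.factorial : ℝ)) := by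
  classical
  set R : Finset (Fin n) → Finset (Finset (Fin n)) := fun A =>
    (kSets n k).filter (fun B => A ≠ B ∧ s < (A ∩ B).card) with hR
  set I : Finset (Σ _ : Finset (Fin n), Finset (Fin n)) := (kSets n k).sigma R with hI
  have hnpos : (0:ℝ) < n := by exact_mod_cast hn
  refine (hprob_union n k p h0 h1 _ I (fun i => {i.1, i.2}) ?_ ?_).trans ?_
  · intro i hi
    simp only [hI, hR, Finset.mem_sigma, Finset.mem_filter] at hi
    intro A hA
    simp only [Finset.mem_insert, Finset.mem_singleton] at hA
    rcases hA with rfl | rfl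
    · exact hi.1
    · exact hi.2.1
  · rintro H hH ⟨A, hA, B, hB, hne, hs⟩
    refine ⟨⟨A, B⟩, ?_, ?_⟩
    · simp only [hI, hR, Finset.mem_sigma, Finset.mem_filter]
      exact ⟨hH hA, hH hB, hne, hs⟩
    · intro X hX
      simp only [Finset.mem_insert, Finset.mem_singleton] at hX
      rcases hX with rfl | rfl <;> assumption
  · have hsum : ∑ i ∈ I, p ^ ({i.1, i.2} : Finset (Finset (Fin n))).card = (I.card : ℝ) * p ^ 2 := by
      rw [Finset.sum_congr rfl (g := fun _ => p ^ 2), Finset.sum_const, nsmul_eq_mul]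
      intro i hi
      simp only [hI, hR, Finset.mem_sigma, Finset.mem_filter] at hi
      rw [Finset.card_pair hi.2.2.1]
    rw [hsum]
    have hRc : ∀ A ∈ kSets n k, ((R A).card : ℝ) ≤
        (n.choose k : ℝ) * (((k:ℝ) ^ 2 / n) ^ s / (s.factorial : ℝ)) := by
      intro A hA
      have hAk : A.card = k := (Finset.mem_powersetCard.1 hA).2
      by_cases hsk : s ≤ k
      · have hsub : R A ⊆ (Finset.powersetCard s A).biUnion
            (fun T => (Finset.powersetCard k Finset.univ).filter (fun B => T ⊆ B)) := by
          intro B hB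
          simp only [hR, Finset.mem_filter] at hB
          obtain ⟨T, hT, hTc⟩ := Finset.exists_subset_card_eq hB.2.2.le
          rw [Finset.mem_biUnion]
          exact ⟨T, Finset.mem_powersetCard.2 ⟨hT.trans Finset.inter_subset_left, hTc⟩,
            Finset.mem_filter.2 ⟨hB.1, hT.trans Finset.inter_subset_right⟩⟩
        have hc : (R A).card ≤ k.choose s * (n - s).choose (k - s) := by
          refine (Finset.card_le_card hsub).trans ?_
          rw [← hAk, ← Finset.card_powersetCard, hAk]
          apply Finset.card_biUnion_le_card_mul
          intro T hT
          have := card_sup_le Finset.univ T (Finset.subset_univ _) k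
          rwa [Finset.card_univ, Fintype.card_fin, (Finset.mem_powersetCard.1 hT).2] at this
        have hc2 := choose_sub_le n k hk s hsk
        have hc2' : ((n - s).choose (k - s) : ℝ) ≤ (k:ℝ) ^ s / n ^ s * (n.choose k : ℝ) := by
          rw [div_mul_eq_mul_div, le_div_iff₀ (by positivity), mul_comm]
          exact_mod_cast hc2
        have hc3 : (k.choose s : ℝ) ≤ (k:ℝ) ^ s / (s.factorial : ℝ) := Nat.choose_le_pow_div s k
        calc ((R A).card : ℝ) ≤ (k.choose s : ℝ) * ((n - s).choose (k - s) : ℝ) := by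
              exact_mod_cast hc
          _ ≤ ((k:ℝ) ^ s / (s.factorial : ℝ)) * ((k:ℝ) ^ s / n ^ s * (n.choose k : ℝ)) := by
              gcongr
          _ = _ := by
              rw [div_pow, ← pow_mul, mul_comm 2 s, pow_mul]
              ring
      · have : R A = ∅ := by
          apply Finset.eq_empty_of_forall_notMem
          intro B hB
          simp only [hR, Finset.mem_filter] at hB
          have := Finset.card_le_card (Finset.inter_subset_left (s₁ := A) (s₂ := B))
          omega
        rw [this]
        simp only [Finset.card_empty, Nat.cast_zero]
        positivity
    have hIc : (I.card : ℝ) ≤ (n.choose k : ℝ) *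
        ((n.choose k : ℝ) * (((k:ℝ) ^ 2 / n) ^ s / (s.factorial : ℝ))) := by
      rw [hI, Finset.card_sigma]
      push_cast
      refine (Finset.sum_le_sum hRc).trans ?_
      rw [Finset.sum_const, nsmul_eq_mul]
      simp [kSets]
    calc _ ≤ ((n.choose k : ℝ) *
        ((n.choose k : ℝ) * (((k:ℝ) ^ 2 / n) ^ s / (s.factorial : ℝ)))) * p ^ 2 := by gcongr
      _ = _ := by ring

lemma E2_bound (n k : ℕ) (p : ℝ) (h0 : 0 ≤ p) (h1 : p ≤ 1) (hk : 2 ≤ k) (h2k : 2 * k < n) :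
    hprob n k p (fun H => ∃ x y : Fin n, x ≠ y ∧
      12 ≤ (H.filter (fun A => x ∈ A ∧ y ∈ A)).card) ≤
      (n:ℝ) ^ 2 * (phi n k p * k / n) ^ 12 := by
  classical
  set X : Fin n × Fin n → Finset (Finset (Fin n)) := fun xy =>
    (kSets n k).filter (fun A => xy.1 ∈ A ∧ xy.2 ∈ A) with hX
  set I : Finset (Σ _ : Fin n × Fin n, Finset (Finset (Fin n))) :=
    (Finset.univ.offDiag).sigma (fun xy => Finset.powersetCard 12 (X xy)) with hI
  have hnpos : (0:ℝ) < n := by exact_mod_cast (by omega : 0 < n)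
  refine (hprob_union n k p h0 h1 _ I (fun i => i.2) ?_ ?_).trans ?_
  · intro i hi
    simp only [hI, hX, Finset.mem_sigma, Finset.mem_powersetCard] at hi
    exact hi.2.1.trans (Finset.filter_subset _ _)
  · rintro H hH ⟨x, y, hxy, hc⟩
    obtain ⟨T, hT, hTc⟩ := Finset.exists_subset_card_eq hc
    refine ⟨⟨(x, y), T⟩, ?_, hT.trans (Finset.filter_subset _ _)⟩
    simp only [hI, hX, Finset.mem_sigma, Finset.mem_powersetCard, Finset.mem_offDiag,
      Finset.mem_univ, true_and]
    exact ⟨hxy, hT.trans (Finset.filter_subset_filter _ hH), hTc⟩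
  · rw [hI, Finset.sum_sigma]
    have hin : ∀ xy ∈ (Finset.univ : Finset (Fin n)).offDiag,
        ∑ S ∈ Finset.powersetCard 12 (X xy), p ^ S.card ≤ (phi n k p * k / n) ^ 12 := by
      intro xy hxy
      rw [Finset.mem_offDiag] at hxy
      rw [Finset.sum_congr rfl (g := fun _ => p ^ 12)
        (fun S hS => by rw [(Finset.mem_powersetCard.1 hS).2]), Finset.sum_const,
        Finset.card_powersetCard, nsmul_eq_mul]
      have hXc : (X xy).card ≤ (n - 2).choose (k - 2) := by
        have := card_sup_le (Finset.univ : Finset (Fin n)) {xy.1, xy.2} (Finset.subset_univ _) k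
        rw [Finset.card_univ, Fintype.card_fin, Finset.card_pair hxy.2.2] at this
        refine le_trans (Finset.card_le_card ?_) this
        intro A hA
        simp only [hX, Finset.mem_filter] at hA
        refine Finset.mem_filter.2 ⟨hA.1, ?_⟩
        intro a ha
        simp only [Finset.mem_insert, Finset.mem_singleton] at ha
        rcases ha with rfl | rfl
        · exact hA.2.1
        · exact hA.2.2
      have hc3 := choose_sub_le (n-1) (k-1) (by omega) 1 (by omega)
      rw [pow_one, pow_one, show n - 1 - 1 = n - 2 by omega, show k - 1 - 1 = k - 2 by omega] at hc3
      have hc3' : ((n - 2).choose (k - 2) : ℝ) ≤ ((n-1).choose (k-1) : ℝ) * (k / n) := by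
        rw [← mul_div_assoc, le_div_iff₀ hnpos]
        have h3 : (((n-1:ℕ):ℝ)) * ((n - 2).choose (k - 2) : ℝ) ≤
          ((k-1:ℕ):ℝ) * ((n-1).choose (k-1) : ℝ) := by exact_mod_cast hc3
        rw [Nat.cast_sub (by omega), Nat.cast_sub (by omega)] at h3
        push_cast at h3
        have hk' : (2:ℝ) ≤ k := by exact_mod_cast hk
        have h2k' : (2:ℝ) * k < n := by exact_mod_cast h2k
        have hn2 : (0:ℝ) < n - 1 := by linarith
        refine le_of_mul_le_mul_right ?_ hn2
        calc _ = (n:ℝ) * (((n:ℝ) - 1) * ((n - 2).choose (k - 2) : ℝ)) := by ring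
          _ ≤ (n:ℝ) * (((k:ℝ) - 1) * ((n-1).choose (k-1) : ℝ)) := by gcongr
          _ = ((n:ℝ) * ((k:ℝ) - 1)) * ((n-1).choose (k-1) : ℝ) := by ring
          _ ≤ ((k:ℝ) * (n - 1)) * ((n-1).choose (k-1) : ℝ) := by
            gcongr ?_ * _
            nlinarith
          _ = _ := by ring
      calc (((X xy).card.choose 12 : ℕ) : ℝ) * p ^ 12 ≤ ((X xy).card : ℝ) ^ 12 * p ^ 12 := by
            gcongr
            exact_mod_cast Nat.choose_le_pow _ _
        _ = (p * ((X xy).card : ℝ)) ^ 12 := by ring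
        _ ≤ (p * (((n-1).choose (k-1) : ℝ) * (k / n))) ^ 12 := by
            gcongr
            refine le_trans ?_ hc3'
            exact_mod_cast hXc
        _ = _ := by unfold phi; ring
    refine (Finset.sum_le_sum hin).trans ?_
    rw [Finset.sum_const, nsmul_eq_mul]
    have hoff : (((Finset.univ : Finset (Fin n)).offDiag.card : ℕ) : ℝ) ≤ (n:ℝ) ^ 2 := by
      have : (Finset.univ : Finset (Fin n)).offDiag.card ≤ n ^ 2 := by
        rw [Finset.offDiag_card, Finset.card_univ, Fintype.card_fin, sq]; omega
      exact_mod_cast this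
    have hphi : 0 ≤ phi n k p := by unfold phi; positivity
    gcongr

/-- the cross-intersecting configuration -/
def E3 (n k m s : ℕ) (H : Finset (Finset (Fin n))) : Prop :=
  ∃ x y : Fin n, x ≠ y ∧ ∃ F ⊆ H, ∃ G ⊆ H, F.card = m ∧ G.card = m ∧
    (∀ A ∈ F, x ∈ A ∧ y ∉ A) ∧ (∀ B ∈ G, y ∈ B ∧ x ∉ B) ∧
    (∀ A ∈ F, ∀ A' ∈ F, A ≠ A' → (A ∩ A').card ≤ s) ∧
    (∀ B ∈ G, ∀ A ∈ F, (A ∩ B).Nonempty)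

lemma E3_bound (n k m s : ℕ) (p : ℝ) (h0 : 0 ≤ p) (h1 : p ≤ 1) (hk : 2 ≤ k) (h2k : 2 * k < n) :
    hprob n k p (E3 n k m s) ≤
      (n:ℝ) ^ 2 * (phi n k p ^ m / (m.factorial : ℝ) *
        ((phi n k p * (interProb n k ^ m + (m : ℝ) ^ 2 * s * k / n)) ^ m /
          (m.factorial : ℝ))) := by
  classical
  set X : Fin n × Fin n → Finset (Finset (Fin n)) := fun xy =>
    (kSets n k).filter (fun A => xy.1 ∈ A ∧ xy.2 ∉ A) with hX
  set Y : Fin n × Fin n → Finset (Finset (Fin n)) → Finset (Finset (Fin n)) := fun xy F =>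
    (kSets n k).filter
      (fun B => (xy.2 ∈ B ∧ xy.1 ∉ B) ∧ ∀ A ∈ F, (A ∩ B).Nonempty) with hY
  set J : Fin n × Fin n → Finset (Finset (Finset (Fin n))) := fun xy =>
    (Finset.powersetCard m (X xy)).filter
      (fun F => ∀ A ∈ F, ∀ A' ∈ F, A ≠ A' → (A ∩ A').card ≤ s) with hJ
  set I : Finset (Σ _ : Fin n × Fin n, Σ _ : Finset (Finset (Fin n)), Finset (Finset (Fin n))) :=
    (Finset.univ.offDiag).sigma (fun xy => (J xy).sigma
      (fun F => Finset.powersetCard m (Y xy F))) with hI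
  have hnpos : (0:ℝ) < n := by exact_mod_cast (by omega : 0 < n)
  have hphi : 0 ≤ phi n k p := by unfold phi; positivity
  have hq0 : 0 ≤ interProb n k := by unfold interProb; positivity
  refine (hprob_union n k p h0 h1 _ I (fun i => i.2.1 ∪ i.2.2) ?_ ?_).trans ?_
  · intro i hi
    simp only [hI, hJ, hX, hY, Finset.mem_sigma, Finset.mem_powersetCard, Finset.mem_filter] at hi
    exact Finset.union_subset (hi.2.1.1.1.trans (Finset.filter_subset _ _))
      (hi.2.2.1.trans (Finset.filter_subset _ _))
  · rintro H hH ⟨x, y, hxy, F, hFH, G, hGH, hFm, hGm, hF, hG, hs, hFG⟩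
    refine ⟨⟨(x, y), ⟨F, G⟩⟩, ?_, Finset.union_subset hFH hGH⟩
    simp only [hI, hJ, hX, hY, Finset.mem_sigma, Finset.mem_powersetCard, Finset.mem_offDiag,
      Finset.mem_univ, true_and, Finset.mem_filter]
    refine ⟨hxy, ⟨⟨?_, hFm⟩, hs⟩, ?_, hGm⟩
    · intro A hA
      exact Finset.mem_filter.2 ⟨hH (hFH hA), hF A hA⟩
    · intro B hB
      exact Finset.mem_filter.2 ⟨hH (hGH hB), hG B hB, hFG B hB⟩
  · rw [hI, Finset.sum_sigma]
    have hin : ∀ xy ∈ (Finset.univ : Finset (Fin n)).offDiag,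
        ∑ i ∈ (J xy).sigma (fun F => Finset.powersetCard m (Y xy F)), p ^ (i.1 ∪ i.2).card ≤
        phi n k p ^ m / (m.factorial : ℝ) *
        ((phi n k p * (interProb n k ^ m + (m : ℝ) ^ 2 * s * k / n)) ^ m /
          (m.factorial : ℝ)) := by
      intro xy hxy
      rw [Finset.mem_offDiag] at hxy
      rw [Finset.sum_sigma]
      have hin2 : ∀ F ∈ J xy, ∑ G ∈ Finset.powersetCard m (Y xy F), p ^ (F ∪ G).card ≤
          p ^ m * ((phi n k p * (interProb n k ^ m + (m : ℝ) ^ 2 * s * k / n)) ^ m /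
          (m.factorial : ℝ)) := by
        intro F hF
        simp only [hJ, hX, Finset.mem_filter, Finset.mem_powersetCard] at hF
        obtain ⟨⟨hFX, hFm⟩, hFs⟩ := hF
        have hF2 : ∀ A ∈ F, A ∈ kSets n k ∧ xy.1 ∈ A ∧ xy.2 ∉ A := fun A hA =>
          Finset.mem_filter.1 (hFX hA)
        rw [Finset.sum_congr rfl (g := fun _ => p ^ (m + m)), Finset.sum_const,
          Finset.card_powersetCard, nsmul_eq_mul]
        · have hYc := SF_card n k hk h2k xy.1 xy.2 hxy.2.2 F hF2 s hFs
          rw [hFm] at hYc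
          have hYc2 : ((Y xy F).card : ℝ) ≤ ((n - 1).choose (k - 1) : ℝ) *
            (interProb n k ^ m + (m : ℝ) ^ 2 * s * k / n) := by
            convert hYc
          calc (((Y xy F).card.choose m : ℕ) : ℝ) * p ^ (m + m) ≤
              ((Y xy F).card : ℝ) ^ m / (m.factorial : ℝ) * p ^ (m + m) := by
                gcongr
                exact Nat.choose_le_pow_div _ _
            _ ≤ (((n - 1).choose (k - 1) : ℝ) *
                (interProb n k ^ m + (m : ℝ) ^ 2 * s * k / n)) ^ m /
                  (m.factorial : ℝ) * p ^ (m + m) := by gcongr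
            _ = _ := by
              unfold phi
              rw [pow_add, mul_assoc p, mul_pow p]
              ring
        · intro G hG
          obtain ⟨hGY, hGm⟩ := Finset.mem_powersetCard.1 hG
          rw [Finset.card_union_of_disjoint, hFm, hGm]
          rw [Finset.disjoint_left]
          intro A hA hA2
          exact (hF2 A hA).2.2 (Finset.mem_filter.1 (hGY hA2)).2.1.1
      refine (Finset.sum_le_sum hin2).trans ?_
      rw [Finset.sum_const, nsmul_eq_mul, ← mul_assoc]
      gcongr ?_ * _
      have hXc : (X xy).card ≤ (n - 1).choose (k - 1) := by
        have := card_sup_le (Finset.univ : Finset (Fin n)) {xy.1} (Finset.subset_univ _) k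
        rw [Finset.card_univ, Fintype.card_fin, Finset.card_singleton] at this
        refine le_trans (Finset.card_le_card ?_) this
        intro A hA
        simp only [hX, Finset.mem_filter] at hA
        exact Finset.mem_filter.2 ⟨hA.1, Finset.singleton_subset_iff.2 hA.2.1⟩
      calc ((J xy).card : ℝ) * p ^ m ≤ (((X xy).card.choose m : ℕ) : ℝ) * p ^ m := by
            gcongr
            rw [← Finset.card_powersetCard]
            exact Finset.card_le_card (Finset.filter_subset _ _)
        _ ≤ ((X xy).card : ℝ) ^ m / (m.factorial : ℝ) * p ^ m := by
            gcongr
            exact Nat.choose_le_pow_div _ _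
        _ ≤ ((n - 1).choose (k - 1) : ℝ) ^ m / (m.factorial : ℝ) * p ^ m := by
            gcongr
        _ = _ := by unfold phi; ring
    refine (Finset.sum_le_sum hin).trans ?_
    rw [Finset.sum_const, nsmul_eq_mul]
    have hoff : (((Finset.univ : Finset (Fin n)).offDiag.card : ℕ) : ℝ) ≤ (n:ℝ) ^ 2 := by
      have : (Finset.univ : Finset (Fin n)).offDiag.card ≤ n ^ 2 := by
        rw [Finset.offDiag_card, Finset.card_univ, Fintype.card_fin, sq]; omega
      exact_mod_cast this
    gcongr

lemma bad_cases (n k m s : ℕ) (lam : ℝ) (hm : m + 11 ≤ ⌈lam⌉₊) (H : Finset (Finset (Fin n)))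
    (h : ∃ C ⊆ H, IsClique C ∧ ∃ x y : Fin n, x ≠ y ∧
        lam ≤ (vdeg C x : ℝ) ∧ lam ≤ (vdeg C y : ℝ)) :
    (∃ A ∈ H, ∃ B ∈ H, A ≠ B ∧ s < (A ∩ B).card) ∨
    (∃ x y : Fin n, x ≠ y ∧ 12 ≤ (H.filter (fun A => x ∈ A ∧ y ∈ A)).card) ∨
    E3 n k m s H := by
  classical
  by_cases h1 : ∃ A ∈ H, ∃ B ∈ H, A ≠ B ∧ s < (A ∩ B).card
  · exact Or.inl h1
  by_cases h2 : ∃ x y : Fin n, x ≠ y ∧ 12 ≤ (H.filter (fun A => x ∈ A ∧ y ∈ A)).card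
  · exact Or.inr (Or.inl h2)
  right; right
  obtain ⟨C, hCH, hC, x, y, hxy, hx, hy⟩ := h
  have key : ∀ a b : Fin n, a ≠ b → lam ≤ (vdeg C a : ℝ) →
      ∃ F ⊆ C, F.card = m ∧ ∀ A ∈ F, a ∈ A ∧ b ∉ A := by
    intro a b hab ha
    have hd : m + 11 ≤ (C.filter (fun A => a ∈ A)).card := hm.trans (Nat.ceil_le.2 ha)
    have hcod : (H.filter (fun A => a ∈ A ∧ b ∈ A)).card < 12 := by
      by_contra hcon
      exact h2 ⟨a, b, hab, not_lt.1 hcon⟩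
    have hcod2 : (C.filter (fun A => a ∈ A ∧ b ∈ A)).card < 12 :=
      lt_of_le_of_lt (Finset.card_le_card (Finset.filter_subset_filter _ hCH)) hcod
    have hsp : (C.filter (fun A => a ∈ A)).card = (C.filter (fun A => a ∈ A ∧ b ∈ A)).card +
        (C.filter (fun A => a ∈ A ∧ b ∉ A)).card := by
      rw [← Finset.filter_filter, ← Finset.filter_filter, Finset.card_filter_add_card_filter_not]
    obtain ⟨F, hF, hFc⟩ := Finset.exists_subset_card_eq
      (show m ≤ (C.filter (fun A => a ∈ A ∧ b ∉ A)).card by omega)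
    exact ⟨F, hF.trans (Finset.filter_subset _ _), hFc, fun A hA => (Finset.mem_filter.1 (hF hA)).2⟩
  obtain ⟨F, hFC, hFm, hF⟩ := key x y hxy hx
  obtain ⟨G, hGC, hGm, hG⟩ := key y x hxy.symm hy
  refine ⟨x, y, hxy, F, hFC.trans hCH, G, hGC.trans hCH, hFm, hGm, hF, hG, ?_, ?_⟩
  · intro A hA A' hA' hne
    by_contra hcon
    exact h1 ⟨A, hCH (hFC hA), A', hCH (hFC hA'), hne, not_le.1 hcon⟩
  · intro B hB A hA
    exact hC A (hFC hA) B (hGC hB)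

lemma q_one_sub (n k : ℕ) (h : 2 * k < n) :
    Real.exp (-((k:ℝ) ^ 2 / ((n:ℝ) - 2 * k))) ≤ 1 - interProb n k := by
  rw [interProb_eq n k (by omega), sub_sub_cancel]
  refine le_trans ?_ (ratio_lower n k h)
  have hn : (2:ℝ) * k < n := by exact_mod_cast h
  have hk : (0:ℝ) ≤ k := by positivity
  have hd : (0:ℝ) < (n:ℝ) - k := by linarith
  have hd2 : (0:ℝ) < (n:ℝ) - 2 * k := by linarith
  have e1 : 1 - (k : ℝ) / ((n : ℝ) - k) = ((n:ℝ) - 2 * k) / ((n:ℝ) - k) := by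
    field_simp; ring
  have hpos : 0 < 1 - (k : ℝ) / ((n : ℝ) - k) := by rw [e1]; positivity
  have hlog := Real.one_sub_inv_le_log_of_pos hpos
  have e2 : 1 - (1 - (k : ℝ) / ((n : ℝ) - k))⁻¹ = -((k:ℝ) / ((n:ℝ) - 2 * k)) := by
    rw [e1, inv_div, eq_neg_iff_add_eq_zero, sub_add, sub_eq_zero, ← sub_div, eq_div_iff hd2.ne']; ring
  rw [e2] at hlog
  calc _ = Real.exp (-((k:ℝ) / ((n:ℝ) - 2 * k))) ^ k := by
        rw [← Real.exp_nat_mul]; congr 1; ring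
    _ ≤ _ := by
        gcongr
        rwa [Real.le_log_iff_exp_le hpos] at hlog

lemma q_lower (n k : ℕ) (h : 2 * k < n) :
    (k:ℝ) ^ 2 / ((n:ℝ) + (k:ℝ) ^ 2) ≤ interProb n k := by
  rw [interProb_eq n k (by omega)]
  have hu := ratio_upper n k h
  have hn : (2:ℝ) * k < n := by exact_mod_cast h
  have hk : (0:ℝ) ≤ k := by positivity
  have hn0 : (0:ℝ) < n := by linarith
  have h1 : (1 - (k : ℝ) / (n : ℝ)) ^ k ≤ Real.exp (-((k:ℝ)^2 / n)) := by
    calc _ ≤ Real.exp (-((k:ℝ)/n)) ^ k := by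
          have : (k:ℝ) / n ≤ 1 := by rw [div_le_one hn0]; linarith
          apply pow_le_pow_left₀ (by linarith)
          have := Real.add_one_le_exp (-((k:ℝ)/n)); linarith
      _ = _ := by rw [← Real.exp_nat_mul]; congr 1; ring
  have h2 : Real.exp (-((k:ℝ)^2 / n)) ≤ 1 / (1 + (k:ℝ)^2/n) := by
    rw [Real.exp_neg, ← one_div]
    apply one_div_le_one_div_of_le (by positivity)
    have := Real.add_one_le_exp ((k:ℝ)^2/n)
    linarith
  have h3 : (1:ℝ) / (1 + (k:ℝ)^2/n) = 1 - (k:ℝ) ^ 2 / ((n:ℝ) + (k:ℝ) ^ 2) := by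
    field_simp; ring
  linarith

lemma L_low (ε : ℝ) (hε0 : 0 < ε) (hε14 : ε < 1 / 4) (n k : ℕ) (hk : 2 ≤ k) (h : 2 * k < n)
    (hk2 : (k:ℝ) ^ 2 ≤ (1/4 - ε) * n * Real.log n) (hkε : 2 * (k:ℝ) ≤ ε * n) :
    0 < interProb n k ∧
    Real.exp (-((1/4 - ε/2) * Real.log n)) ≤ Real.log (1 / interProb n k) := by
  have hn : (2:ℝ) * k < n := by exact_mod_cast h
  have hk' : (2:ℝ) ≤ k := by exact_mod_cast hk
  have hn0 : (0:ℝ) < n := by linarith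
  have hq := q_lower n k h
  have hq0 : 0 < interProb n k := lt_of_lt_of_le (by positivity) hq
  refine ⟨hq0, ?_⟩
  have hlog : Real.log (interProb n k) ≤ interProb n k - 1 := Real.log_le_sub_one_of_pos hq0
  have h1 := q_one_sub n k h
  rw [one_div (interProb n k), Real.log_inv]
  have hl0 : 0 ≤ Real.log n := Real.log_natCast_nonneg n
  have : (k:ℝ) ^ 2 / ((n:ℝ) - 2 * k) ≤ (1/4 - ε/2) * Real.log n := by
    rw [div_le_iff₀ (by linarith)]
    refine hk2.trans ?_
    have : (1/4 - ε) * n ≤ (1/4 - ε/2) * ((n:ℝ) - 2 * k) := by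
      have : (1/4 - ε/2) * ((1 - ε) * n) ≤ (1/4 - ε/2) * ((n:ℝ) - 2 * k) := by
        apply mul_le_mul_of_nonneg_left _ (by linarith)
        linarith
      nlinarith [mul_pos hε0 hn0, mul_pos (mul_pos hε0 hε0) hn0]
    nlinarith [mul_le_mul_of_nonneg_right this hl0]
  have h2 : Real.exp (-((1/4 - ε/2) * Real.log n)) ≤
      Real.exp (-((k:ℝ) ^ 2 / ((n:ℝ) - 2 * k))) := Real.exp_le_exp.2 (by linarith)
  linarith

/-- facts about λ -/
lemma lam_facts (ε l L lam : ℝ) (hε0 : 0 < ε) (hε14 : ε < 1 / 4) (hl : 1 ≤ l) (hL : 0 < L)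
    (hLl : L ≤ (ε / 40) ^ 2 * l) (P5 : Real.sqrt l ≤ ε * l / 4)
    (hlam : lam = max (Real.sqrt l / L) (2 * Real.sqrt (l / L))) :
    320 ≤ lam ∧ lam ≤ 2 * l / L ∧ lam * L ≤ ε * l / 4 ∧ Real.sqrt l ≤ lam * L ∧
      4 * l ≤ lam ^ 2 * L := by
  have hl0 : 0 < l := by linarith
  have hlam1 : Real.sqrt l / L ≤ lam := by rw [hlam]; exact le_max_left _ _
  have hlam2 : 2 * Real.sqrt (l / L) ≤ lam := by rw [hlam]; exact le_max_right _ _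
  have hr : (40 / ε) ^ 2 ≤ l / L := by
    rw [le_div_iff₀ hL]
    calc (40 / ε) ^ 2 * L ≤ (40 / ε) ^ 2 * ((ε / 40) ^ 2 * l) := by gcongr
      _ = l := by field_simp
  have h40 : 160 ≤ 40 / ε := by rw [le_div_iff₀ hε0]; linarith
  have hs : 40 / ε ≤ Real.sqrt (l / L) := Real.le_sqrt_of_sq_le hr
  have hss : Real.sqrt (l / L) ^ 2 = l / L := Real.sq_sqrt (by positivity)
  have hsl : Real.sqrt l ^ 2 = l := Real.sq_sqrt hl0.le
  have hsl1 : 1 ≤ Real.sqrt l := Real.one_le_sqrt.2 hl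
  have e : l / L * L = l := by field_simp
  refine ⟨by linarith, ?_, ?_, ?_, ?_⟩
  · rw [hlam]
    apply max_le
    · gcongr
      nlinarith
    · rw [mul_div_assoc]
      gcongr
      nlinarith
  · have : lam ≤ (ε * l / 4) / L := by
      rw [hlam]
      apply max_le
      · gcongr
      · have : Real.sqrt (l / L) * (40 / ε) ≤ l / L := by nlinarith
        have h3 : Real.sqrt (l / L) ≤ l / L * (ε / 40) := by
          calc Real.sqrt (l / L) = Real.sqrt (l / L) * (40 / ε) * (ε / 40) := by field_simp
            _ ≤ _ := by gcongr
        calc 2 * Real.sqrt (l / L) ≤ 2 * (l / L * (ε / 40)) := by gcongr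
          _ = (ε * l / 20) / L := by ring
          _ ≤ _ := by
            gcongr ?_ / L
            nlinarith
    rwa [le_div_iff₀ hL] at this
  · rwa [div_le_iff₀ hL] at hlam1
  · have : 4 * (l / L) ≤ lam ^ 2 := by
      nlinarith [Real.sqrt_nonneg (l / L)]
    calc 4 * l = 4 * (l / L) * L := by rw [mul_assoc, e]
      _ ≤ _ := by gcongr

lemma num_E1 (l x u : ℝ) (s : ℕ) (hl : 1 ≤ l) (P1 : l ^ 6 ≤ Real.exp l)
    (hx0 : 0 ≤ x) (hx : x ≤ l ^ 3 * Real.exp (5 / 4 * l)) (hu0 : 0 ≤ u) (hu : u ≤ l / 4)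
    (hs : 10 * l ≤ s) :
    x ^ 2 * (u ^ s / (s.factorial : ℝ)) ≤ Real.exp (-(l / 2)) := by
  have h1 : (Real.exp 1 * u) ^ s / (s.factorial : ℝ) ≤ Real.exp (Real.exp 1 * u) :=
    Real.pow_div_factorial_le_exp _ (by positivity) s
  have he : Real.exp 1 ≤ 4 := by have := Real.exp_one_lt_d9; linarith
  have h2 : u ^ s / (s.factorial : ℝ) ≤ Real.exp (l - 10 * l) := by
    calc u ^ s / (s.factorial : ℝ) =
        (Real.exp 1 * u) ^ s / (s.factorial : ℝ) * Real.exp (-(s:ℝ)) := by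
          rw [mul_pow, ← Real.exp_nat_mul, mul_one, Real.exp_neg]
          field_simp
      _ ≤ Real.exp (Real.exp 1 * u) * Real.exp (-(s:ℝ)) := by gcongr
      _ = Real.exp (Real.exp 1 * u - s) := by rw [← Real.exp_add]; congr 1
      _ ≤ _ := by
        apply Real.exp_le_exp.2
        nlinarith
  calc _ ≤ (l ^ 3 * Real.exp (5 / 4 * l)) ^ 2 * Real.exp (l - 10 * l) := by gcongr
    _ = l ^ 6 * Real.exp (5 / 2 * l + (l - 10 * l)) := by
      rw [mul_pow, ← Real.exp_nat_mul, Real.exp_add, ← pow_mul]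
      push_cast
      rw [show (2:ℝ) * (5 / 4 * l) = 5 / 2 * l by ring]
      ring
    _ ≤ Real.exp l * Real.exp (5 / 2 * l + (l - 10 * l)) := by gcongr
    _ = Real.exp (l + (5 / 2 * l + (l - 10 * l))) := by rw [← Real.exp_add]
    _ ≤ _ := by
      apply Real.exp_le_exp.2
      linarith

lemma num_E2 (l x N : ℝ) (hl : 1 ≤ l) (P2 : l ^ 48 ≤ Real.exp (l / 2))
    (hx0 : 0 ≤ x) (hx : x ≤ l ^ 4 * Real.exp (-(l / 4))) (hN : N = Real.exp l) :
    N ^ 2 * x ^ 12 ≤ Real.exp (-(l / 2)) := by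
  calc _ ≤ N ^ 2 * (l ^ 4 * Real.exp (-(l / 4))) ^ 12 := by gcongr
    _ = l ^ 48 * Real.exp (-l) := by
      rw [hN, mul_pow, ← Real.exp_nat_mul, ← Real.exp_nat_mul, ← pow_mul, mul_left_comm,
        ← Real.exp_add]
      congr 2
      push_cast
      ring
    _ ≤ Real.exp (l / 2) * Real.exp (-l) := by gcongr
    _ = _ := by rw [← Real.exp_add]; congr 1; ring

lemma num_E3 (l L φ N w : ℝ) (m : ℕ) (hl : 1 ≤ l) (hL : 0 < L)
    (P4 : 8 * Real.exp 2 * l ^ 6 ≤ Real.exp (Real.sqrt l / 10))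
    (hφ0 : 0 ≤ φ) (hφ : φ ≤ l ^ 3 / L) (hN : N = Real.exp l)
    (hw0 : 0 ≤ w) (hw : w ≤ Real.exp (-L) ^ m)
    (hm1 : 0.9 * Real.sqrt l ≤ m * L) (hm2 : 3.24 * l ≤ (m:ℝ) ^ 2 * L) :
    N ^ 2 * (φ ^ m / (m.factorial : ℝ) * ((φ * (Real.exp (-L) ^ m + w)) ^ m /
          (m.factorial : ℝ))) ≤ Real.exp (-(l / 2)) := by
  have hsl1 : 1 ≤ Real.sqrt l := Real.one_le_sqrt.2 hl
  have hφm : φ ≤ 2 * l ^ 3 * m := by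
    have h1 : 1 / L ≤ 2 * m := by
      rw [div_le_iff₀ hL]; nlinarith
    calc φ ≤ l ^ 3 / L := hφ
      _ = l ^ 3 * (1 / L) := by ring
      _ ≤ l ^ 3 * (2 * m) := by gcongr
      _ = _ := by ring
  have hfac : (m:ℝ) ^ m / (m.factorial : ℝ) ≤ Real.exp 1 ^ m := by
    rw [← Real.exp_nat_mul, mul_one]
    exact Real.pow_div_factorial_le_exp _ (by positivity) m
  have hA : φ ^ m / (m.factorial : ℝ) ≤ (2 * l ^ 3 * Real.exp 1) ^ m := by
    calc φ ^ m / (m.factorial : ℝ) ≤ (2 * l ^ 3 * m) ^ m / (m.factorial : ℝ) := by gcongr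
      _ = (2 * l ^ 3) ^ m * ((m:ℝ) ^ m / (m.factorial : ℝ)) := by rw [mul_pow]; ring
      _ ≤ (2 * l ^ 3) ^ m * Real.exp 1 ^ m := by gcongr
      _ = _ := by rw [← mul_pow]
  have hB : (φ * (Real.exp (-L) ^ m + w)) ^ m / (m.factorial : ℝ) ≤
      (2 * l ^ 3 * Real.exp 1) ^ m * (2 * Real.exp (-L) ^ m) ^ m := by
    calc _ ≤ (φ * (2 * Real.exp (-L) ^ m)) ^ m / (m.factorial : ℝ) := by
          gcongr; linarith
      _ = φ ^ m / (m.factorial : ℝ) * (2 * Real.exp (-L) ^ m) ^ m := by rw [mul_pow]; ring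
      _ ≤ _ := by gcongr
  have he2 : Real.exp 2 = Real.exp 1 ^ 2 := by rw [← Real.exp_nat_mul]; norm_num
  calc _ ≤ N ^ 2 * ((2 * l ^ 3 * Real.exp 1) ^ m *
        ((2 * l ^ 3 * Real.exp 1) ^ m * (2 * Real.exp (-L) ^ m) ^ m)) := by gcongr
    _ = N ^ 2 * ((8 * Real.exp 2 * l ^ 6) ^ m * (Real.exp (-L) ^ m) ^ m) := by
      rw [← mul_pow, ← mul_pow, ← mul_pow, he2]
      congr 2
      ring
    _ ≤ N ^ 2 * ((Real.exp (Real.sqrt l / 10)) ^ m * (Real.exp (-L) ^ m) ^ m) := by gcongr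
    _ = Real.exp (2 * l + (m * (Real.sqrt l / 10) + m * (m * (-L)))) := by
      rw [hN, Real.exp_add, Real.exp_add, ← Real.exp_nat_mul, ← Real.exp_nat_mul,
        ← Real.exp_nat_mul, ← Real.exp_nat_mul]
      push_cast
      rfl
    _ ≤ _ := by
      apply Real.exp_le_exp.2
      have hm0 : (0:ℝ) ≤ m := by positivity
      have := mul_le_mul_of_nonneg_left hm1 hm0
      nlinarith

set_option maxHeartbeats 2000000 in
/-- all bounds combined, for fixed `n`. -/
lemma main_fixed (ε : ℝ) (hε0 : 0 < ε) (hε14 : ε < 1 / 4) (n k : ℕ) (p : ℝ)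
    (h0 : 0 ≤ p) (h1 : p ≤ 1) (hk : 2 ≤ k) (h2k : 2 * k < n)
    (hk2 : (k:ℝ) ^ 2 ≤ (1/4 - ε) * n * Real.log n) (hkε : 2 * (k:ℝ) ≤ ε * n)
    (hLl : Real.log (1 / interProb n k) ≤ (ε / 40) ^ 2 * Real.log n)
    (hφ : phi n k p ≤ phiStar n k) (hl : 1 ≤ Real.log n)
    (P1 : (Real.log n) ^ 6 ≤ Real.exp (Real.log n))
    (P2 : (Real.log n) ^ 48 ≤ Real.exp (Real.log n / 2))
    (P3 : 44 * (Real.log n) ^ 4 ≤ Real.exp (ε / 2 * Real.log n))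
    (P4 : 8 * Real.exp 2 * (Real.log n) ^ 6 ≤ Real.exp (Real.sqrt (Real.log n) / 10))
    (P5 : Real.sqrt (Real.log n) ≤ ε * Real.log n / 4) :
    hprob n k p (fun H => ∃ C ⊆ H, IsClique C ∧ ∃ x y : Fin n, x ≠ y ∧
        lamP n k ≤ (vdeg C x : ℝ) ∧ lamP n k ≤ (vdeg C y : ℝ)) ≤
      3 * Real.exp (-(Real.log n / 2)) := by
  obtain ⟨hq0, hLlow⟩ := L_low ε hε0 hε14 n k hk h2k hk2 hkε
  have hnpos : (0:ℝ) < n := by exact_mod_cast (by omega : 0 < n)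
  have hNl : (n:ℝ) = Real.exp (Real.log n) := (Real.exp_log hnpos).symm
  set l := Real.log n with hldef
  set L := Real.log (1 / interProb n k) with hLdef
  set φ := phi n k p with hφdef
  have hL : 0 < L := lt_of_lt_of_le (Real.exp_pos _) hLlow
  have hqL : interProb n k = Real.exp (-L) := by
    rw [hLdef, one_div (interProb n k), Real.log_inv, neg_neg, Real.exp_log hq0]
  obtain ⟨hlam320, hlamup, hlamL, hlam1, hlam2⟩ :=
    lam_facts ε l L (lamP n k) hε0 hε14 hl hL hLl P5 rfl
  have hφ0 : 0 ≤ φ := by rw [hφdef]; unfold phi; positivity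
  have hφ' : φ ≤ l ^ 3 / L := hφ
  have hLinv : 1 / L ≤ Real.exp ((1/4 - ε/2) * l) := by
    rw [div_le_iff₀ hL]
    calc (1:ℝ) = Real.exp ((1/4 - ε/2) * l) * Real.exp (-((1/4 - ε/2) * l)) := by
          rw [← Real.exp_add]; simp
      _ ≤ _ := by gcongr
  have hφ2 : φ ≤ l ^ 3 * Real.exp ((1/4 - ε/2) * l) := by
    calc φ ≤ l ^ 3 * (1 / L) := by rw [mul_one_div]; exact hφ'
      _ ≤ _ := by gcongr
  have hφ3 : φ ≤ l ^ 3 * Real.exp (l / 4) := by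
    refine hφ2.trans ?_
    gcongr
    nlinarith
  have hk' : (2:ℝ) ≤ k := by exact_mod_cast hk
  have hkn : (k:ℝ) / n ≤ l * Real.exp (-(l / 2)) := by
    rw [div_le_iff₀ hnpos]
    have hn2 : (n:ℝ) = Real.exp (l/2) ^ 2 := by
      rw [hNl, ← Real.exp_nat_mul]; congr 1; push_cast; ring
    have : l * Real.exp (-(l / 2)) * n = l * Real.exp (l/2) := by
      rw [hNl, mul_assoc, ← Real.exp_add]; congr 2; ring
    rw [this]
    apply le_of_sq_le_sq _ (by positivity)
    rw [mul_pow, ← hn2]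
    refine hk2.trans ?_
    have : (1/4 - ε) * (n * l) ≤ 1 * (n * l) := by
      apply mul_le_mul_of_nonneg_right (by linarith) (by positivity)
    nlinarith [mul_le_mul_of_nonneg_left hl (by positivity : 0 ≤ (n:ℝ) * l)]
  set s := ⌈10 * l⌉₊ with hs
  have hs1 : 10 * l ≤ s := Nat.le_ceil _
  have hs2 : (s:ℝ) ≤ 11 * l := by
    have := Nat.ceil_lt_add_one (by linarith : 0 ≤ 10 * l)
    linarith
  set m := ⌈lamP n k⌉₊ - 11 with hm
  have hlam0 : 0 ≤ lamP n k := by linarith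
  have hceil1 : lamP n k ≤ ⌈lamP n k⌉₊ := Nat.le_ceil _
  have hceil2 := Nat.ceil_lt_add_one hlam0
  have hc11 : 11 ≤ ⌈lamP n k⌉₊ := by
    have : (11:ℝ) ≤ ⌈lamP n k⌉₊ := by linarith
    exact_mod_cast this
  have hmc : (m:ℝ) = ⌈lamP n k⌉₊ - 11 := by rw [hm, Nat.cast_sub hc11]; norm_num
  have hm_up : (m:ℝ) ≤ lamP n k := by linarith
  have hm_lo : 0.9 * lamP n k ≤ m := by linarith
  have hm0 : (0:ℝ) ≤ m := by positivity
  refine (hprob_or3 n k p h0 h1 _ _ _ _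
    (fun H _ hH => bad_cases n k m s (lamP n k) (by omega) H hH)).trans ?_
  have b1 := E1_bound n k s p h0 h1 (by omega) (by omega)
  have b2 := E2_bound n k p h0 h1 hk h2k
  have b3 := E3_bound n k m s p h0 h1 hk h2k
  rw [← hφdef] at b2 b3
  have c1 : (p * (n.choose k : ℝ)) ^ 2 * (((k:ℝ) ^ 2 / n) ^ s / (s.factorial : ℝ)) ≤
      Real.exp (-(l / 2)) := by
    apply num_E1 l _ _ s hl P1 (by positivity) _ (by positivity) _ hs1
    · have e := Nat.add_one_mul_choose_eq (n - 1) (k - 1)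
      rw [show n - 1 + 1 = n by omega, show k - 1 + 1 = k by omega] at e
      have e' : (n:ℝ) * ((n-1).choose (k-1) : ℝ) = (n.choose k : ℝ) * k := by exact_mod_cast e
      have h3 : p * (n.choose k : ℝ) ≤ φ * n := by
        calc p * (n.choose k : ℝ) ≤ p * ((n.choose k : ℝ) * k) := by
              gcongr
              have : (0:ℝ) ≤ (n.choose k : ℝ) := by positivity
              nlinarith
          _ = φ * n := by rw [← e', hφdef]; unfold phi; ring
      calc _ ≤ φ * n := h3
        _ ≤ (l ^ 3 * Real.exp (l / 4)) * n := by gcongr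
        _ = _ := by
          rw [hNl, mul_assoc, ← Real.exp_add]; congr 2; ring
    · rw [div_le_iff₀ hnpos]
      refine hk2.trans ?_
      nlinarith [mul_pos hε0 (mul_pos hnpos (by linarith : 0 < l))]
  have c2 : (n:ℝ) ^ 2 * (φ * k / n) ^ 12 ≤ Real.exp (-(l / 2)) := by
    apply num_E2 l _ _ hl P2 (by positivity) _ hNl
    calc φ * k / n = φ * (k / n) := by ring
      _ ≤ (l ^ 3 * Real.exp (l / 4)) * (l * Real.exp (-(l / 2))) := by gcongr
      _ = l ^ 4 * (Real.exp (l / 4) * Real.exp (-(l/2))) := by ring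
      _ = _ := by rw [← Real.exp_add]; congr 2; ring
  have c3 : (n:ℝ) ^ 2 * (φ ^ m / (m.factorial : ℝ) *
        ((φ * (interProb n k ^ m + (m : ℝ) ^ 2 * s * k / n)) ^ m /
          (m.factorial : ℝ))) ≤ Real.exp (-(l / 2)) := by
    rw [hqL]
    apply num_E3 l L φ n _ m hl hL P4 hφ0 hφ' hNl (by positivity)
    · have hmup2 : (m:ℝ) ≤ 2 * l * Real.exp ((1/4 - ε/2) * l) := by
        calc (m:ℝ) ≤ 2 * l / L := hm_up.trans hlamup
          _ = 2 * l * (1 / L) := by ring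
          _ ≤ _ := by gcongr
      calc (m:ℝ) ^ 2 * s * k / n = (m:ℝ) ^ 2 * s * (k / n) := by ring
        _ ≤ (2 * l * Real.exp ((1/4 - ε/2) * l)) ^ 2 * (11 * l) * (l * Real.exp (-(l / 2))) := by
          gcongr
        _ = 44 * l ^ 4 * (Real.exp ((1/4 - ε/2) * l) ^ 2 * Real.exp (-(l / 2))) := by ring
        _ = 44 * l ^ 4 * Real.exp (-(ε * l)) := by
          rw [← Real.exp_nat_mul, ← Real.exp_add]; congr 2; push_cast; ring
        _ ≤ Real.exp (ε / 2 * l) * Real.exp (-(ε * l)) := by gcongr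
        _ = Real.exp (-(ε * l / 2)) := by rw [← Real.exp_add]; congr 1; ring
        _ ≤ Real.exp (m * (-L)) := by
          apply Real.exp_le_exp.2
          have : (m:ℝ) * L ≤ lamP n k * L := by gcongr
          have hel : 0 < ε * l := by positivity
          linarith
        _ = _ := by rw [Real.exp_nat_mul]
    · calc 0.9 * Real.sqrt l ≤ 0.9 * (lamP n k * L) := by gcongr
        _ = (0.9 * lamP n k) * L := by ring
        _ ≤ _ := by gcongr
    · calc 3.24 * l = 0.9 ^ 2 * (4 * l) := by ring
        _ ≤ 0.9 ^ 2 * (lamP n k ^ 2 * L) := by gcongr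
        _ = (0.9 * lamP n k) ^ 2 * L := by ring
        _ ≤ _ := by gcongr
  linarith [b1.trans c1, b2.trans c2, b3.trans c3]

lemma ev_pow (j : ℕ) (c b : ℝ) (hc : 0 < c) (hb : 0 < b) :
    ∀ᶠ x : ℝ in atTop, c * x ^ j ≤ Real.exp (b * x) := by
  have h := (isLittleO_pow_exp_pos_mul_atTop j hb).bound (inv_pos.2 hc)
  filter_upwards [h, eventually_ge_atTop 0] with x hx hx0
  rw [Real.norm_of_nonneg (by positivity), Real.norm_of_nonneg (by positivity)] at hx
  calc c * x ^ j ≤ c * (c⁻¹ * Real.exp (b * x)) := by gcongr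
    _ = _ := by field_simp

lemma L_up (η : ℝ) (n k : ℕ) (d : ℝ) (hk : 1 ≤ k) (h2k : 2 * k < n)
    (hd : d ≤ η / 4) (hl : 1 ≤ Real.log n) (hklow : (n : ℝ) ^ ((1 : ℝ) / 2 - d) < (k : ℝ))
    (hk2 : (k:ℝ) ^ 2 ≤ n * Real.log n)
    (hP : 2 * (Real.log n) ^ 1 ≤ Real.exp (η / 2 * Real.log n)) :
    Real.log (1 / interProb n k) ≤ η * Real.log n := by
  have hnpos : (0:ℝ) < n := by exact_mod_cast (by omega : 0 < n)
  have hNl : (n:ℝ) = Real.exp (Real.log n) := (Real.exp_log hnpos).symm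
  have hq := q_lower n k h2k
  have hkp : (0:ℝ) < k := by exact_mod_cast (by omega : 0 < k)
  rw [Real.rpow_def_of_pos hnpos] at hklow
  set l := Real.log n with hldef
  rw [pow_one] at hP
  have h1 : Real.exp (l - η / 2 * l) ≤ (k:ℝ) ^ 2 := by
    calc Real.exp (l - η / 2 * l) ≤ Real.exp (l * (1/2 - d)) ^ 2 := by
          rw [← Real.exp_nat_mul]
          apply Real.exp_le_exp.2
          push_cast
          nlinarith
      _ ≤ _ := by gcongr
  have h2 : (n:ℝ) + (k:ℝ) ^ 2 ≤ n * Real.exp (η / 2 * l) := by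
    nlinarith
  have h3 : Real.exp (-(η * l)) ≤ interProb n k := by
    refine le_trans ?_ hq
    rw [le_div_iff₀ (by positivity)]
    calc _ ≤ Real.exp (-(η * l)) * (n * Real.exp (η / 2 * l)) := by gcongr
      _ = Real.exp (l - η / 2 * l) := by
        rw [hNl, ← Real.exp_add, ← Real.exp_add]; congr 1; ring
      _ ≤ _ := h1
  have hq0 : 0 < interProb n k := lt_of_lt_of_le (Real.exp_pos _) h3
  rw [one_div, Real.log_inv]
  have := (Real.le_log_iff_exp_le hq0).2 h3
  linarith

end helpers

/-- **Lemma B.** Under the standing assumptions, almost surely `H = H_k(n,p)` contains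
no clique having two vertices each of clique-degree at least `λ`. -/
theorem no_clique_with_two_big_degrees
    (ε : ℝ) (hε0 : 0 < ε) (hε14 : ε < 1 / 4)
    (k : ℕ → ℕ) (p : ℕ → ℝ)
    (hp0 : ∀ n, 0 ≤ p n) (hp1 : ∀ n, p n ≤ 1)
    (hnk : ∀ᶠ n in atTop, 2 * k n < n)
    (δ : ℕ → ℝ) (hδ : Tendsto δ atTop (nhds 0))
    (hklow : ∀ᶠ n : ℕ in atTop, (n : ℝ) ^ ((1 : ℝ) / 2 - δ n) < (k n : ℝ))
    (hkup : ∀ᶠ n in atTop, (k n : ℝ) < Real.sqrt ((1 / 4 - ε) * n * Real.log n))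
    (σ υ : ℕ → ℝ) (hσ : Tendsto σ atTop (nhds 0)) (hυ : Tendsto υ atTop (nhds 0))
    (hLam : ∀ᶠ n in atTop,
      hprob n (k n) (p n) (fun H => σ n < Lam n (k n) (p n) (maxDegree H)) < υ n)
    (hφ : ∀ᶠ n in atTop, phi n (k n) (p n) ≤ phiStar n (k n))
    :
    Tendsto (fun n => hprob n (k n) (p n) (fun H =>
      ¬ ∃ C ⊆ H, IsClique C ∧ ∃ x y : Fin n, x ≠ y ∧
        lamP n (k n) ≤ (vdeg C x : ℝ) ∧ lamP n (k n) ≤ (vdeg C y : ℝ)))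
      atTop (nhds 1) := by
  have hlog : Tendsto (fun n : ℕ => Real.log (n:ℝ)) atTop atTop :=
    Real.tendsto_log_atTop.comp tendsto_natCast_atTop_atTop
  set η : ℝ := (ε / 40) ^ 2 with hη
  have hη0 : 0 < η := by positivity
  have q0 := hlog.eventually (eventually_ge_atTop 1)
  have q1 := hlog.eventually (ev_pow 6 1 1 one_pos one_pos)
  have q2 := hlog.eventually (ev_pow 48 1 (1/2) one_pos (by norm_num))
  have q3 := hlog.eventually (ev_pow 4 44 (ε/2) (by norm_num) (by positivity))
  have q4 := (Real.tendsto_sqrt_atTop.comp hlog).eventually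
    (ev_pow 12 (8 * Real.exp 2) (1/10) (by positivity) (by norm_num))
  have q5 := (Real.tendsto_sqrt_atTop.comp hlog).eventually (eventually_ge_atTop (4 / ε))
  have q6 := hlog.eventually (ev_pow 1 (ε ^ 2)⁻¹ 1 (by positivity) one_pos)
  have q7 := hlog.eventually (ev_pow 1 2 (η / 2) (by positivity) (by positivity))
  have q8 := hδ.eventually (eventually_le_nhds (show (0:ℝ) < η / 4 by positivity))
  have q9 := hδ.eventually (eventually_le_nhds (show (0:ℝ) < 1 / 2 by norm_num))
  have hmain : ∀ᶠ n : ℕ in atTop, hprob n (k n) (p n) (fun H =>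
      ∃ C ⊆ H, IsClique C ∧ ∃ x y : Fin n, x ≠ y ∧
        lamP n (k n) ≤ (vdeg C x : ℝ) ∧ lamP n (k n) ≤ (vdeg C y : ℝ)) ≤
      3 * Real.exp (-(Real.log n / 2)) := by
    filter_upwards [q0, q1, q2, q3, q4, q5, q6, q7, q8, q9, hnk, hklow, hkup, hφ]
      with n q0 q1 q2 q3 q4 q5 q6 q7 q8 q9 hnk hklow hkup hφ
    have hnpos : (0:ℝ) < n := by exact_mod_cast (by omega : 0 < n)
    have hn1 : (1:ℝ) ≤ n := by exact_mod_cast (by omega : 1 ≤ n)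
    have hl0 : 0 < Real.log n := by linarith
    have hsl : Real.sqrt (Real.log n) ^ 2 = Real.log n := Real.sq_sqrt hl0.le
    have hk2 : (k n : ℝ) ^ 2 ≤ (1/4 - ε) * n * Real.log n :=
      ((Real.lt_sqrt (by positivity)).1 hkup).le
    have hk2b : (k n : ℝ) ^ 2 ≤ n * Real.log n / 4 := by
      nlinarith [mul_pos hε0 (mul_pos hnpos hl0)]
    have hk : 2 ≤ k n := by
      have : (1:ℝ) ≤ (n : ℝ) ^ ((1 : ℝ) / 2 - δ n) := Real.one_le_rpow hn1 (by linarith)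
      have h2 : (1:ℝ) < k n := lt_of_le_of_lt this hklow
      exact_mod_cast h2
    have hlε : Real.log n ≤ ε ^ 2 * n := by
      rw [one_mul, Real.exp_log hnpos, pow_one, inv_mul_le_iff₀ (by positivity)] at q6
      exact q6
    have hkε : 2 * (k n : ℝ) ≤ ε * n := by
      apply le_of_sq_le_sq _ (by positivity)
      have := mul_le_mul_of_nonneg_left hlε hnpos.le
      nlinarith
    refine main_fixed ε hε0 hε14 n (k n) (p n) (hp0 n) (hp1 n) hk hnk hk2 hkε ?_ hφ q0
      (by simpa using q1) ?_ q3 ?_ ?_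
    · refine L_up η n (k n) (δ n) (by omega) hnk q8 q0 hklow ?_ q7
      have : 0 < n * Real.log n := by positivity
      linarith
    · rw [one_mul] at q2
      rwa [show Real.log n / 2 = 1 / 2 * Real.log n by ring]
    · simp only [Function.comp] at q4
      rw [show Real.sqrt (Real.log n) / 10 = 1 / 10 * Real.sqrt (Real.log n) by ring]
      refine le_trans (le_of_eq ?_) q4
      rw [show 12 = 2 * 6 by norm_num, pow_mul, hsl]
    · simp only [Function.comp] at q5
      rw [div_le_iff₀ hε0] at q5
      have h0 := Real.sqrt_nonneg (Real.log n)
      have := mul_le_mul_of_nonneg_left q5 h0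
      nlinarith
  have hzero : Tendsto (fun n : ℕ => hprob n (k n) (p n) (fun H =>
      ∃ C ⊆ H, IsClique C ∧ ∃ x y : Fin n, x ≠ y ∧
        lamP n (k n) ≤ (vdeg C x : ℝ) ∧ lamP n (k n) ≤ (vdeg C y : ℝ))) atTop (nhds 0) := by
    refine squeeze_zero' (Eventually.of_forall fun n => hprob_nonneg _ _ _ (hp0 n) (hp1 n) _)
      hmain ?_
    have : Tendsto (fun n : ℕ => Real.exp (-(Real.log n / 2))) atTop (nhds 0) :=
      Real.tendsto_exp_neg_atTop_nhds_zero.comp (hlog.atTop_div_const (by norm_num))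
    simpa using this.const_mul 3
  have hfin := hzero.const_sub 1
  rw [sub_zero] at hfin
  refine hfin.congr fun n => ?_
  exact (hprob_not _ _ _ _).symm
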